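/- Fix s > 1. There exists a constant C > 0 (depending only on s) such that every Fourier-side solution a of the cubic defocusing NLS (the case v ≡ 0), defined for all t ∈ ℝ with ‖a(t)‖_{H^s} < ∞ for all t, satisfies ‖a(t)‖_{H^s} ≤ t^{C(s−1)}·‖a(0)‖_{H^s} for all sufficiently large t. -/

import Mathlib

noncomputable section

open scoped BigOperators

/-- We identify the two-torus side with the Fourier side: modes are indexed by `ℤ × ℤ`. -/
abbrev Z2 := ℤ × ℤ

/-- The squared Euclidean norm `|n|²` of a mode `n ∈ ℤ²`, as a real number. -/
def nsq (n : Z2) : ℝ := (n.1 : ℝ) ^ 2 + (n.2 : ℝ) ^ 2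

/-- Triples of modes. -/
abbrev Triple := Z2 × Z2 × Z2

/-- The cubic nonlinearity term `a_{n₁} ⋅ conj(a_{n₂}) ⋅ a_{n₃}` attached to a triple. -/
def cubicTerm (a : Z2 → ℂ) (p : Triple) : ℂ :=
  a p.1 * (starRingEnd ℂ) (a p.2.1) * a p.2.2

/-- A Fourier-side solution of the cubic defocusing NLS with convolution potential `V`,
whose (real) Fourier coefficients are `v`: for every `n` and `t`, the sum over triples
`n₁ - n₂ + n₃ = n` converges absolutely, `a_n` is differentiable in `t`, and
`-i a_n'(t) = (|n|² + v_n) a_n(t) + ∑_{n₁-n₂+n₃=n} a_{n₁} conj(a_{n₂}) a_{n₃}`. -/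
def IsSolutionV (v : Z2 → ℝ) (a : ℝ → Z2 → ℂ) : Prop :=
  ∀ (n : Z2) (t : ℝ),
    Summable (fun p : {p : Triple // p.1 - p.2.1 + p.2.2 = n} => ‖cubicTerm (a t) p.1‖) ∧
    ∃ d : ℂ, HasDerivAt (fun τ : ℝ => a τ n) d t ∧
      -Complex.I * d =
        ((nsq n + v n : ℝ) : ℂ) * a t n +
          ∑' p : {p : Triple // p.1 - p.2.1 + p.2.2 = n}, cubicTerm (a t) p.1

/-- The square of the `H^s` Sobolev norm `∑ (1+|n|²)^s |a_n|²`. -/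
def HsNormSq (s : ℝ) (a : Z2 → ℂ) : ℝ := ∑' n : Z2, (1 + nsq n) ^ s * ‖a n‖ ^ 2

/-- Finiteness of the `H^s` norm. -/
def HsFinite (s : ℝ) (a : Z2 → ℂ) : Prop :=
  Summable fun n : Z2 => (1 + nsq n) ^ s * ‖a n‖ ^ 2

/-- The `H^s` Sobolev norm. -/
def HsNorm (s : ℝ) (a : Z2 → ℂ) : ℝ := HsNormSq s a ^ (1 / 2 : ℝ)

/-- The `L²` (mass) norm. -/
def L2Norm (a : Z2 → ℂ) : ℝ := (∑' n : Z2, ‖a n‖ ^ 2) ^ (1 / 2 : ℝ)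

open scoped ENNReal NNReal ComplexConjugate
open MeasureTheory Set

/-! ### Lattice sums -/

/-- The squared Japanese bracket `⟨n⟩² = 1 + |n|²`. -/
def jb (n : Z2) : ℝ := 1 + nsq n

/-- The mode closing a triple to a resonant-momentum quadruple `n₁ - n₂ + n₃ - n₄ = 0`. -/
def fourth (p : Triple) : Z2 := p.1 - p.2.1 + p.2.2

/-- The resonance function `|n₁|² - |n₂|² + |n₃|² - |n₄|²`. -/
def resonance (p : Triple) : ℝ := nsq p.1 - nsq p.2.1 + nsq p.2.2 - nsq (fourth p)

lemma nsq_nonneg (n : Z2) : 0 ≤ nsq n := by unfold nsq; positivity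

lemma one_le_jb (n : Z2) : 1 ≤ jb n := by
  have := nsq_nonneg n
  unfold jb; linarith

lemma jb_pos (n : Z2) : 0 < jb n := lt_of_lt_of_le one_pos (one_le_jb n)

lemma summable_int_one_add_sq_rpow {b : ℝ} (hb : 1 / 2 < b) :
    Summable fun k : ℤ => (1 + (k : ℝ) ^ 2) ^ (-b) := by
  have h := Real.summable_abs_int_rpow (b := 2 * b) (by linarith)
  refine h.of_norm_bounded_eventually ?_
  have : {0}ᶜ ∈ (Filter.cofinite : Filter ℤ) :=
    (Set.finite_singleton (0 : ℤ)).compl_mem_cofinite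
  filter_upwards [this] with k hk
  have hk' : (0 : ℝ) < |(k : ℝ)| := by simpa using hk
  rw [Real.norm_of_nonneg (by positivity), show -(2 * b) = 2 * (-b) by ring,
    Real.rpow_mul hk'.le]
  apply Real.rpow_le_rpow_of_nonpos (by positivity) _ (by linarith)
  rw [Real.rpow_two, sq_abs]; linarith

lemma tsum_ofReal_lt_top {ι : Type*} {f : ι → ℝ} (hf : Summable f) :
    ∑' i, ENNReal.ofReal (f i) < ∞ := by
  have h := hf.norm
  have h2 : Summable fun i => ‖f i‖₊ := by
    rw [← NNReal.summable_coe]; simpa using h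
  have h3 := ENNReal.tsum_coe_ne_top_iff_summable.2 h2
  refine lt_of_le_of_lt (ENNReal.tsum_le_tsum fun i => ?_) h3.lt_top
  rw [ENNReal.ofReal, ENNReal.coe_le_coe]
  exact Real.toNNReal_le_iff_le_coe.2 (le_abs_self _)

lemma exists_tsum_int_shifted_le :
    ∃ C : ℝ≥0, ∀ ρ : ℝ, ∑' l : ℤ, ENNReal.ofReal (1 / (1 + 2 * ((l : ℝ) - ρ) ^ 2)) ≤ C := by
  have h : Summable fun k : ℤ => 3 * (1 + (k : ℝ) ^ 2) ^ (-1 : ℝ) :=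
    (summable_int_one_add_sq_rpow (by norm_num)).mul_left 3
  have hlt := tsum_ofReal_lt_top h
  refine ⟨(∑' k : ℤ, ENNReal.ofReal (3 * (1 + (k : ℝ) ^ 2) ^ (-1 : ℝ))).toNNReal, fun ρ => ?_⟩
  rw [ENNReal.coe_toNNReal hlt.ne, ← (Equiv.addRight ⌊ρ⌋).tsum_eq]
  refine ENNReal.tsum_le_tsum fun k => ENNReal.ofReal_le_ofReal ?_
  have h1 := Int.floor_le ρ
  have h2 := Int.lt_floor_add_one ρ
  rw [Real.rpow_neg_one, Equiv.coe_addRight, Int.cast_add, ← div_eq_mul_inv,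
    div_le_div_iff₀ (by positivity) (by positivity)]
  set d : ℝ := ρ - ⌊ρ⌋
  have hd : d ^ 2 ≤ 1 := by
    have : 0 ≤ d := by simp only [d]; linarith
    have : d ≤ 1 := by simp only [d]; linarith
    nlinarith
  have : (k : ℝ) + ⌊ρ⌋ - ρ = k - d := by simp only [d]; ring
  rw [this]
  nlinarith [sq_nonneg ((k : ℝ) - 2 * d), sq_nonneg ((k : ℝ) - d)]

lemma exists_tsum_int_quadratic_le :
    ∃ C : ℝ≥0, ∀ r c : ℝ,
      ∑' l : ℤ, ENNReal.ofReal (1 / (1 + |2 * ((l : ℝ) - r) ^ 2 - c|)) ≤ C := by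
  obtain ⟨C, hC⟩ := exists_tsum_int_shifted_le
  refine ⟨C + C, fun r c => ?_⟩
  set d := √(max c 0 / 2)
  have hd : 2 * d ^ 2 = max c 0 := by
    rw [Real.sq_sqrt (by positivity)]; ring
  calc _ ≤ ∑' l : ℤ, (ENNReal.ofReal (1 / (1 + 2 * ((l : ℝ) - (r + d)) ^ 2)) +
        ENNReal.ofReal (1 / (1 + 2 * ((l : ℝ) - (r - d)) ^ 2))) := by
        refine ENNReal.tsum_le_tsum fun l => ?_
        rw [← ENNReal.ofReal_add (by positivity) (by positivity)]
        refine ENNReal.ofReal_le_ofReal ?_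
        set y : ℝ := l - r
        have hd0 : 0 ≤ d := Real.sqrt_nonneg _
        have e1 : (l : ℝ) - (r + d) = y - d := by simp only [y]; ring
        have e2 : (l : ℝ) - (r - d) = y + d := by simp only [y]; ring
        rw [e1, e2]
        have key : 2 * (y - d) ^ 2 ≤ |2 * y ^ 2 - c| ∨ 2 * (y + d) ^ 2 ≤ |2 * y ^ 2 - c| := by
          have habs : |2 * y ^ 2 - 2 * d ^ 2| ≤ |2 * y ^ 2 - c| := by
            rw [hd]
            rcases le_total c 0 with hc | hc
            · rw [max_eq_right hc, sub_zero, abs_of_nonneg (by positivity),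
                abs_of_nonneg (by nlinarith [sq_nonneg y])]
              linarith
            · rw [max_eq_left hc]
          rcases le_total 0 y with hy | hy
          · left; refine le_trans ?_ habs
            rcases le_total d y with h | h
            · rw [abs_of_nonneg (by nlinarith)]; nlinarith
            · rw [abs_of_nonpos (by nlinarith)]; nlinarith
          · right; refine le_trans ?_ habs
            rcases le_total d (-y) with h | h
            · rw [abs_of_nonneg (by nlinarith)]; nlinarith
            · rw [abs_of_nonpos (by nlinarith)]; nlinarith
        rcases key with h | h
        · have : 1 / (1 + |2 * y ^ 2 - c|) ≤ 1 / (1 + 2 * (y - d) ^ 2) := by gcongr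
          have : 0 ≤ 1 / (1 + 2 * (y + d) ^ 2) := by positivity
          linarith
        · have : 1 / (1 + |2 * y ^ 2 - c|) ≤ 1 / (1 + 2 * (y + d) ^ 2) := by gcongr
          have : 0 ≤ 1 / (1 + 2 * (y - d) ^ 2) := by positivity
          linarith
    _ ≤ C + C := by
        rw [ENNReal.tsum_add]; exact add_le_add (hC _) (hC _)

/-- Uniform bound for the lattice points close to a circle, weighted by a power of their size. -/
lemma exists_tsum_near_circle_le :
    ∃ C : ℝ≥0, ∀ n₁ n₃ : Z2,
      ∑' n₂ : Z2, ENNReal.ofReal (jb n₂ ^ (-(3 / 4) : ℝ) / (1 + |resonance (n₁, n₂, n₃)|)) ≤ C := by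
  obtain ⟨C, hC⟩ := exists_tsum_int_quadratic_le
  have hs := tsum_ofReal_lt_top (summable_int_one_add_sq_rpow (b := 3 / 4) (by norm_num))
  set D := (∑' k : ℤ, ENNReal.ofReal ((1 + (k : ℝ) ^ 2) ^ (-(3 / 4) : ℝ))).toNNReal
  refine ⟨D * C, fun n₁ n₃ => ?_⟩
  rw [ENNReal.tsum_prod', ENNReal.coe_mul, ENNReal.coe_toNNReal hs.ne, ← ENNReal.tsum_mul_right]
  refine ENNReal.tsum_le_tsum fun k => ?_
  set c : ℝ := nsq n₁ + nsq n₃ - (k : ℝ) ^ 2 - ((n₁.1 : ℝ) - k + n₃.1) ^ 2 -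
    ((n₁.2 : ℝ) + n₃.2) ^ 2 / 2
  refine le_trans ?_ (mul_le_mul_right (hC (((n₁.2 : ℝ) + n₃.2) / 2) c) _)
  rw [← ENNReal.tsum_mul_left]
  refine ENNReal.tsum_le_tsum fun l => ?_
  rw [← ENNReal.ofReal_mul (by positivity)]
  refine ENNReal.ofReal_le_ofReal ?_
  have e : resonance (n₁, (k, l), n₃) = -(2 * ((l : ℝ) - ((n₁.2 : ℝ) + n₃.2) / 2) ^ 2 - c) := by
    simp only [resonance, fourth, nsq, c, Prod.fst_add, Prod.fst_sub, Prod.snd_add, Prod.snd_sub]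
    push_cast; ring
  rw [e, abs_neg, div_eq_mul_one_div]
  gcongr ?_ * _
  apply Real.rpow_le_rpow_of_nonpos (by positivity) _ (by norm_num)
  simp only [jb, nsq]; nlinarith [sq_nonneg (l : ℝ)]

lemma tsum_rpow_jb_lt_top {b : ℝ} (hb : 1 < b) :
    ∑' n : Z2, ENNReal.ofReal (jb n ^ (-b)) < ∞ := by
  have hs := tsum_ofReal_lt_top (summable_int_one_add_sq_rpow (b := b / 2) (by linarith))
  refine lt_of_le_of_lt ?_ (ENNReal.mul_lt_top hs hs)
  rw [ENNReal.tsum_prod', ← ENNReal.tsum_mul_right]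
  refine ENNReal.tsum_le_tsum fun k => ?_
  rw [← ENNReal.tsum_mul_left]
  refine ENNReal.tsum_le_tsum fun l => ?_
  rw [← ENNReal.ofReal_mul (by positivity)]
  refine ENNReal.ofReal_le_ofReal ?_
  rw [← Real.mul_rpow (by positivity) (by positivity), show -b = 2 * -(b / 2) by ring,
    Real.rpow_mul (jb_pos _).le]
  apply Real.rpow_le_rpow_of_nonpos (by positivity) _ (by linarith)
  rw [Real.rpow_two]
  simp only [jb, nsq]; nlinarith [sq_nonneg (l : ℝ), sq_nonneg (k : ℝ),
    mul_nonneg (sq_nonneg (l : ℝ)) (sq_nonneg (k : ℝ)), sq_nonneg ((k : ℝ) ^ 2), sq_nonneg ((l : ℝ) ^ 2)]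

/-- Cauchy–Schwarz for sums in `[0, ∞]`. -/
lemma tsum_le_sqrt_mul_sqrt {ι : Type*} {h u v : ι → ℝ≥0∞} (H : ∀ i, h i ^ 2 ≤ u i * v i) :
    ∑' i, h i ≤ (∑' i, u i) ^ (1 / 2 : ℝ) * (∑' i, v i) ^ (1 / 2 : ℝ) := by
  let _ : MeasurableSpace ι := ⊤
  have hpq : (2 : ℝ).HolderConjugate 2 := Real.HolderConjugate.two_two
  have key := ENNReal.lintegral_mul_le_Lp_mul_Lq MeasureTheory.Measure.count hpq
    (f := fun i => u i ^ (1 / 2 : ℝ)) (g := fun i => v i ^ (1 / 2 : ℝ))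
    (measurable_from_top).aemeasurable (measurable_from_top).aemeasurable
  simp only [MeasureTheory.lintegral_count, Pi.mul_apply, ← ENNReal.rpow_mul] at key
  norm_num at key
  refine le_trans (ENNReal.tsum_le_tsum fun i => ?_) key
  rw [← ENNReal.mul_rpow_of_nonneg _ _ (by norm_num)]
  calc h i = (h i ^ 2) ^ (1 / 2 : ℝ) := by
        rw [← ENNReal.rpow_natCast, ← ENNReal.rpow_mul]; norm_num
    _ ≤ _ := by gcongr; exact H i

/-! ### Symmetries of quadruples -/

/-- The symmetry `n₁ ↔ n₂`, `n₃ ↔ n₄` of quadruples. -/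
def swapPairs : Triple ≃ Triple :=
  Function.Involutive.toPerm (fun p => (p.2.1, p.1, fourth p)) fun p => by
    simp only [fourth]; ext <;> simp <;> ring

/-- The symmetry `n₂ ↔ n₄` of quadruples. -/
def flipEven : Triple ≃ Triple :=
  Function.Involutive.toPerm (fun p => (p.1, fourth p, p.2.2)) fun p => by
    simp only [fourth]; ext <;> simp <;> ring

/-- The symmetry `n₁ ↔ n₃` of quadruples. -/
def flipOdd : Triple ≃ Triple :=
  Function.Involutive.toPerm (fun p => (p.2.2, p.2.1, p.1)) fun _ => rfl

lemma swapPairs_apply (p : Triple) : swapPairs p = (p.2.1, p.1, fourth p) := rfl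
lemma flipEven_apply (p : Triple) : flipEven p = (p.1, fourth p, p.2.2) := rfl
lemma flipOdd_apply (p : Triple) : flipOdd p = (p.2.2, p.2.1, p.1) := rfl

lemma fourth_swapPairs (p : Triple) : fourth (swapPairs p) = p.2.2 := by
  simp only [fourth, swapPairs_apply]; abel
lemma fourth_flipEven (p : Triple) : fourth (flipEven p) = p.2.1 := by
  simp only [fourth, flipEven_apply]; abel
lemma fourth_flipOdd (p : Triple) : fourth (flipOdd p) = fourth p := by
  simp only [fourth, flipOdd_apply]; abel

lemma resonance_swapPairs (p : Triple) : resonance (swapPairs p) = -resonance p := by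
  rw [resonance, resonance, fourth_swapPairs, swapPairs_apply]; ring
lemma resonance_flipEven (p : Triple) : resonance (flipEven p) = resonance p := by
  rw [resonance, resonance, fourth_flipEven, flipEven_apply]; ring

/-! ### Multilinear estimates for nonnegative sequences -/

/-- The squared `H^r` norm of a nonnegative sequence, with values in `[0, ∞]`. -/
def sobolevE (r : ℝ) (c : Z2 → ℝ≥0∞) : ℝ≥0∞ := ∑' n, ENNReal.ofReal (jb n ^ r) * c n ^ 2

/-- The product of a sequence over the four modes of a quadruple. -/
def prod4 (c : Z2 → ℝ≥0∞) (p : Triple) : ℝ≥0∞ := c p.1 * c p.2.1 * c p.2.2 * c (fourth p)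

/-- The trilinear convolution of a nonnegative sequence. -/
def conv3 (c : Z2 → ℝ≥0∞) (n : Z2) : ℝ≥0∞ :=
  ∑' p : {p : Triple // p.1 - p.2.1 + p.2.2 = n}, c p.1.1 * c p.1.2.1 * c p.1.2.2

lemma prod4_swapPairs (c : Z2 → ℝ≥0∞) (p : Triple) : prod4 c (swapPairs p) = prod4 c p := by
  rw [prod4, prod4, fourth_swapPairs, swapPairs_apply]; ring
lemma prod4_flipEven (c : Z2 → ℝ≥0∞) (p : Triple) : prod4 c (flipEven p) = prod4 c p := by
  rw [prod4, prod4, fourth_flipEven, flipEven_apply]; ring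

lemma tsum_fourth_fiber (G : Z2 → Triple → ℝ≥0∞) :
    ∑' n, ∑' p : {p : Triple // p.1 - p.2.1 + p.2.2 = n}, G n p.1 = ∑' p, G (fourth p) p := by
  rw [← (Equiv.sigmaFiberEquiv fourth).tsum_eq, ENNReal.tsum_sigma']
  refine tsum_congr fun n => tsum_congr fun p => ?_
  have : fourth p.1 = n := p.2
  simp [Equiv.sigmaFiberEquiv, this]

lemma sobolevE_mono {r r' : ℝ} (h : r ≤ r') (c : Z2 → ℝ≥0∞) : sobolevE r c ≤ sobolevE r' c := by
  refine ENNReal.tsum_le_tsum fun n => ?_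
  gcongr
  exact one_le_jb n

lemma sqrt_sq_ennreal (x : ℝ≥0∞) : (x ^ (1 / 2 : ℝ)) ^ 2 = x := by
  rw [← ENNReal.rpow_natCast, ← ENNReal.rpow_mul]; norm_num

lemma sqrt_mul_self_ennreal (x : ℝ≥0∞) : x ^ (1 / 2 : ℝ) * x ^ (1 / 2 : ℝ) = x := by
  rw [← sq, sqrt_sq_ennreal]

lemma tsum_sq_le {ε : ℝ} (hε : 0 < ε) :
    ∃ C : ℝ≥0, ∀ c : Z2 → ℝ≥0∞, (∑' n, c n) ^ 2 ≤ C * sobolevE (1 + ε) c := by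
  have hs := tsum_rpow_jb_lt_top (b := 1 + ε) (by linarith)
  refine ⟨(∑' n : Z2, ENNReal.ofReal (jb n ^ (-(1 + ε)))).toNNReal, fun c => ?_⟩
  rw [ENNReal.coe_toNNReal hs.ne]
  have := tsum_le_sqrt_mul_sqrt (h := c) (u := fun n : Z2 => ENNReal.ofReal (jb n ^ (-(1 + ε))))
    (v := fun n => ENNReal.ofReal (jb n ^ (1 + ε)) * c n ^ 2) fun n => by
      have hp := jb_pos n
      rw [← mul_assoc, ← ENNReal.ofReal_mul (by positivity), ← Real.rpow_add hp]
      simp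
  calc _ ≤ _ := pow_le_pow_left' this 2
    _ = _ := by rw [mul_pow, sqrt_sq_ennreal, sqrt_sq_ennreal]; rfl

lemma jb_fourth_le (p : Triple) :
    jb (fourth p) ≤ 3 * (jb p.1 + jb p.2.1 + jb p.2.2) := by
  obtain ⟨⟨a, b⟩, ⟨c, d⟩, ⟨e, f⟩⟩ := p
  simp only [fourth, jb, nsq, Prod.mk_sub_mk, Prod.mk_add_mk]
  push_cast
  nlinarith [sq_nonneg ((a : ℝ) + c), sq_nonneg ((a : ℝ) - e), sq_nonneg ((c : ℝ) + e),
    sq_nonneg ((b : ℝ) + d), sq_nonneg ((b : ℝ) - f), sq_nonneg ((d : ℝ) + f)]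

lemma jb_fourth_rpow_le {r : ℝ} (hr : 0 ≤ r) (p : Triple) :
    jb (fourth p) ^ r ≤ 9 ^ r * (jb p.1 ^ r + jb p.2.1 ^ r + jb p.2.2 ^ r) := by
  have h := jb_fourth_le p
  have h1 := jb_pos p.1
  have h2 := jb_pos p.2.1
  have h3 := jb_pos p.2.2
  have h4 := jb_pos (fourth p)
  have key : ∀ x > 0, jb (fourth p) ≤ 9 * x → jb (fourth p) ^ r ≤ 9 ^ r * x ^ r := by
    intro x hx hle
    rw [← Real.mul_rpow (by norm_num) hx.le]
    exact Real.rpow_le_rpow h4.le hle hr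
  have : jb (fourth p) ≤ 9 * jb p.1 ∨ jb (fourth p) ≤ 9 * jb p.2.1 ∨
      jb (fourth p) ≤ 9 * jb p.2.2 := by
    by_contra! hcon
    linarith [hcon.1, hcon.2.1, hcon.2.2]
  have p1 : 0 ≤ jb p.1 ^ r := by positivity
  have p2 : 0 ≤ jb p.2.1 ^ r := by positivity
  have p3 : 0 ≤ jb p.2.2 ^ r := by positivity
  have p9 : (0 : ℝ) ≤ 9 ^ r := by positivity
  rcases this with h | h | h
  · exact (key _ h1 h).trans (by gcongr; linarith)
  · exact (key _ h2 h).trans (by gcongr; linarith)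
  · exact (key _ h3 h).trans (by gcongr; linarith)

lemma tsum_fiber_le (n : Z2) (f : Triple → Z2 × Z2) (c : Z2 → ℝ≥0∞)
    (hf : Function.Injective fun p : {p : Triple // p.1 - p.2.1 + p.2.2 = n} => f p.1) :
    ∑' p : {p : Triple // p.1 - p.2.1 + p.2.2 = n}, c (f p.1).1 * c (f p.1).2 ≤
      (∑' n, c n) ^ 2 := by
  refine (ENNReal.tsum_comp_le_tsum_of_injective hf fun q : Z2 × Z2 => c q.1 * c q.2).trans ?_
  rw [ENNReal.tsum_prod', sq, ← ENNReal.tsum_mul_right]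
  simp only [ENNReal.tsum_mul_left]; rfl

lemma tsum_triple_mul (f g h : Z2 → ℝ≥0∞) :
    ∑' p : Triple, f p.1 * (g p.2.1 * h p.2.2) = (∑' n, f n) * ((∑' n, g n) * ∑' n, h n) := by
  rw [ENNReal.tsum_prod', ← ENNReal.tsum_mul_right]
  refine tsum_congr fun a => ?_
  simp only [ENNReal.tsum_mul_left]
  rw [ENNReal.tsum_prod', ← ENNReal.tsum_mul_right]
  simp only [ENNReal.tsum_mul_left]

lemma diag_sum_le (a b c x y z : ℝ≥0∞) :
    a * x + b * y + c * z ≤ (a + b + c) * (x + y + z) := by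
  rw [add_mul, add_mul]
  gcongr
  · rw [add_assoc]; exact le_self_add
  · rw [add_right_comm]; exact le_add_self
  · exact le_add_self

/-- Young's inequality: the trilinear convolution is bounded on `H^r ∩ ℓ¹`. -/
lemma sobolevE_conv3_le {r : ℝ} (hr : 0 ≤ r) (c : Z2 → ℝ≥0∞) :
    sobolevE r (conv3 c) ≤
      ENNReal.ofReal (9 * 9 ^ r) * (∑' n, c n) ^ 4 * sobolevE r c := by
  set ℓ := ∑' n, c n
  set w : Z2 → ℝ≥0∞ := fun n => ENNReal.ofReal (jb n ^ r)
  let u : Triple → ℝ≥0∞ := fun p => w p.1 * c p.1 ^ 2 * (c p.2.1 * c p.2.2) +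
    w p.2.1 * c p.2.1 ^ 2 * (c p.1 * c p.2.2) + w p.2.2 * c p.2.2 ^ 2 * (c p.1 * c p.2.1)
  let v : Triple → ℝ≥0∞ := fun p => c p.2.1 * c p.2.2 + c p.1 * c p.2.2 + c p.1 * c p.2.1
  have hv : ∀ n, ∑' p : {p : Triple // p.1 - p.2.1 + p.2.2 = n}, v p.1 ≤ 3 * ℓ ^ 2 := by
    intro n
    simp only [v]
    rw [ENNReal.tsum_add, ENNReal.tsum_add, show (3 : ℝ≥0∞) * ℓ ^ 2 = ℓ ^ 2 + ℓ ^ 2 + ℓ ^ 2 by ring]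
    refine add_le_add (add_le_add ?_ ?_) ?_
    · refine tsum_fiber_le n (fun p => (p.2.1, p.2.2)) c ?_
      rintro ⟨⟨a, b, d⟩, h⟩ ⟨⟨a', b', d'⟩, h'⟩ heq
      simp only [Prod.mk.injEq] at heq h h' ⊢
      obtain ⟨rfl, rfl⟩ := heq
      have : a = a' := by
        have := h.trans h'.symm
        simpa using this
      simp [this]
    · refine tsum_fiber_le n (fun p => (p.1, p.2.2)) c ?_
      rintro ⟨⟨a, b, d⟩, h⟩ ⟨⟨a', b', d'⟩, h'⟩ heq
      simp only [Prod.mk.injEq] at heq h h' ⊢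
      obtain ⟨rfl, rfl⟩ := heq
      have : b = b' := by
        have := h.trans h'.symm
        simpa using this
      simp [this]
    · refine tsum_fiber_le n (fun p => (p.1, p.2.1)) c ?_
      rintro ⟨⟨a, b, d⟩, h⟩ ⟨⟨a', b', d'⟩, h'⟩ heq
      simp only [Prod.mk.injEq] at heq h h' ⊢
      obtain ⟨rfl, rfl⟩ := heq
      have : d = d' := by
        have := h.trans h'.symm
        simpa using this
      simp [this]
  have hu : ∑' p, u p = 3 * (ℓ ^ 2 * sobolevE r c) := by
    have e1 : ∑' p : Triple, w p.1 * c p.1 ^ 2 * (c p.2.1 * c p.2.2) = ℓ ^ 2 * sobolevE r c := by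
      rw [tsum_triple_mul (fun n => w n * c n ^ 2) c c, mul_comm, sq]; rfl
    have e2 : ∑' p : Triple, w p.2.1 * c p.2.1 ^ 2 * (c p.1 * c p.2.2) = ℓ ^ 2 * sobolevE r c := by
      have := tsum_triple_mul c (fun n => w n * c n ^ 2) c
      rw [mul_left_comm, mul_comm, mul_comm _ (∑' n, c n), ← sq] at this
      exact (tsum_congr fun p => by ring).trans this
    have e3 : ∑' p : Triple, w p.2.2 * c p.2.2 ^ 2 * (c p.1 * c p.2.1) = ℓ ^ 2 * sobolevE r c := by
      have := tsum_triple_mul c c (fun n => w n * c n ^ 2)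
      rw [← mul_assoc, ← sq] at this
      exact (tsum_congr fun p => by ring).trans this
    simp only [u]
    rw [ENNReal.tsum_add, ENNReal.tsum_add, e1, e2, e3]; ring
  have hn : ∀ n, w n * conv3 c n ^ 2 ≤ 3 * ℓ ^ 2 * ENNReal.ofReal (9 ^ r) *
      ∑' p : {p : Triple // p.1 - p.2.1 + p.2.2 = n}, u p.1 := by
    intro n
    have h1 := tsum_le_sqrt_mul_sqrt
      (h := fun p : {p : Triple // p.1 - p.2.1 + p.2.2 = n} =>
        w n ^ (1 / 2 : ℝ) * (c p.1.1 * c p.1.2.1 * c p.1.2.2))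
      (u := fun p => ENNReal.ofReal (9 ^ r) * u p.1) (v := fun p => v p.1) fun p => by
        have hp : fourth p.1 = n := p.2
        have hw : w n ≤ ENNReal.ofReal (9 ^ r) * (w p.1.1 + w p.1.2.1 + w p.1.2.2) := by
          have h1 := jb_pos p.1.1
          have h2 := jb_pos p.1.2.1
          have h3 := jb_pos p.1.2.2
          simp only [w]
          rw [← ENNReal.ofReal_add (by positivity) (by positivity),
            ← ENNReal.ofReal_add (by positivity) (by positivity),
            ← ENNReal.ofReal_mul (by positivity)]
          have := jb_fourth_rpow_le hr p.1
          rw [hp] at this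
          exact ENNReal.ofReal_le_ofReal this
        rw [mul_pow, sqrt_sq_ennreal]
        refine (mul_le_mul_left hw _).trans ?_
        rw [mul_assoc, mul_assoc (ENNReal.ofReal (9 ^ r))]
        refine mul_le_mul_right (le_trans (le_of_eq ?_) (diag_sum_le _ _ _ _ _ _)) _
        ring
    rw [ENNReal.tsum_mul_left, ENNReal.tsum_mul_left] at h1
    have h2 := pow_le_pow_left' h1 2
    rw [mul_pow, mul_pow, sqrt_sq_ennreal, sqrt_sq_ennreal, sqrt_sq_ennreal] at h2
    refine h2.trans ((mul_le_mul_right (hv n) _).trans (le_of_eq ?_))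
    ring
  calc sobolevE r (conv3 c) ≤ ∑' n, 3 * ℓ ^ 2 * ENNReal.ofReal (9 ^ r) *
      ∑' p : {p : Triple // p.1 - p.2.1 + p.2.2 = n}, u p.1 := ENNReal.tsum_le_tsum hn
    _ = _ := by
      rw [ENNReal.tsum_mul_left, tsum_fourth_fiber (fun _ p => u p), hu,
        ENNReal.ofReal_mul (by norm_num)]
      rw [show ENNReal.ofReal 9 = 9 by simp]
      ring

/-- The sum of the weights `⟨n⟩^{2r}` over a quadruple. -/
def weightSum (r : ℝ) (p : Triple) : ℝ :=
  jb p.1 ^ r + jb p.2.1 ^ r + jb p.2.2 ^ r + jb (fourth p) ^ r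

/-- The alternating sum of the weights `⟨n⟩^{2r}` over a quadruple. -/
def weightAlt (r : ℝ) (p : Triple) : ℝ :=
  jb p.1 ^ r - jb p.2.1 ^ r + jb p.2.2 ^ r - jb (fourth p) ^ r

lemma jb_rpow_nonneg (r : ℝ) (n : Z2) : 0 ≤ jb n ^ r := Real.rpow_nonneg (jb_pos n).le r

lemma weightSum_nonneg (r : ℝ) (p : Triple) : 0 ≤ weightSum r p := by
  have h := jb_rpow_nonneg r
  unfold weightSum
  linarith [h p.1, h p.2.1, h p.2.2, h (fourth p)]

lemma tsum_weight_fourth_le {r : ℝ} (hr : 0 ≤ r) (c : Z2 → ℝ≥0∞) :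
    ∑' p, ENNReal.ofReal (jb (fourth p) ^ r) * prod4 c p ≤
      ENNReal.ofReal (9 * 9 ^ r) ^ (1 / 2 : ℝ) * (∑' n, c n) ^ 2 * sobolevE r c := by
  have h1 : ∑' p, ENNReal.ofReal (jb (fourth p) ^ r) * prod4 c p =
      ∑' n, ENNReal.ofReal (jb n ^ r) * c n * conv3 c n := by
    refine (tsum_fourth_fiber (fun n p =>
      ENNReal.ofReal (jb n ^ r) * (c p.1 * c p.2.1 * c p.2.2 * c n))).symm.trans ?_
    refine tsum_congr fun n => ?_
    rw [conv3, ← ENNReal.tsum_mul_left]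
    exact tsum_congr fun p => by ring
  have h2 := tsum_le_sqrt_mul_sqrt (h := fun n => ENNReal.ofReal (jb n ^ r) * c n * conv3 c n)
    (u := fun n => ENNReal.ofReal (jb n ^ r) * c n ^ 2)
    (v := fun n => ENNReal.ofReal (jb n ^ r) * conv3 c n ^ 2) fun n => le_of_eq (by ring)
  rw [h1]
  refine h2.trans ((mul_le_mul_right
    (ENNReal.rpow_le_rpow (sobolevE_conv3_le hr c) (by norm_num)) _).trans (le_of_eq ?_))
  rw [ENNReal.mul_rpow_of_nonneg _ _ (by norm_num), ENNReal.mul_rpow_of_nonneg _ _ (by norm_num)]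
  have e : ((∑' n, c n) ^ 4) ^ (1 / 2 : ℝ) = (∑' n, c n) ^ 2 := by
    rw [← ENNReal.rpow_natCast, ← ENNReal.rpow_mul, ← ENNReal.rpow_natCast]; norm_num
  rw [e]
  change sobolevE r c ^ (1 / 2 : ℝ) * _ = _
  calc _ = ENNReal.ofReal (9 * 9 ^ r) ^ (1 / 2 : ℝ) * (∑' n, c n) ^ 2 *
        (sobolevE r c ^ (1 / 2 : ℝ) * sobolevE r c ^ (1 / 2 : ℝ)) := by ring
    _ = _ := by rw [sqrt_mul_self_ennreal]

lemma exists_tsum_weightSum_le {r : ℝ} (hr : 0 ≤ r) : ∃ C : ℝ≥0, ∀ c : Z2 → ℝ≥0∞,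
    ∑' p, ENNReal.ofReal (weightSum r p) * prod4 c p ≤ C * (∑' n, c n) ^ 2 * sobolevE r c := by
  have hfin : ENNReal.ofReal (9 * 9 ^ r) ^ (1 / 2 : ℝ) ≠ ∞ :=
    ENNReal.rpow_ne_top_of_nonneg (by norm_num) ENNReal.ofReal_ne_top
  refine ⟨4 * (ENNReal.ofReal (9 * 9 ^ r) ^ (1 / 2 : ℝ)).toNNReal, fun c => ?_⟩
  rw [ENNReal.coe_mul, ENNReal.coe_toNNReal hfin]
  have h4 := tsum_weight_fourth_le hr c
  set S := ∑' p, ENNReal.ofReal (jb (fourth p) ^ r) * prod4 c p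
  have h3 : ∑' p : Triple, ENNReal.ofReal (jb p.2.2 ^ r) * prod4 c p = S := by
    rw [← swapPairs.tsum_eq]
    exact tsum_congr fun p => by rw [prod4_swapPairs, swapPairs_apply]
  have h2 : ∑' p : Triple, ENNReal.ofReal (jb p.2.1 ^ r) * prod4 c p = S := by
    rw [← flipEven.tsum_eq]
    exact tsum_congr fun p => by rw [prod4_flipEven, flipEven_apply]
  have h1 : ∑' p : Triple, ENNReal.ofReal (jb p.1 ^ r) * prod4 c p = S := by
    rw [← h2, ← swapPairs.tsum_eq]
    exact tsum_congr fun p => by rw [prod4_swapPairs, swapPairs_apply]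
  calc _ = S + S + S + S := by
        nth_rw 1 [← h1]; nth_rw 1 [← h2]; nth_rw 1 [← h3]
        simp only [S]
        rw [← ENNReal.tsum_add, ← ENNReal.tsum_add, ← ENNReal.tsum_add]
        refine tsum_congr fun p => ?_
        have h := jb_rpow_nonneg r
        rw [weightSum, ENNReal.ofReal_add, ENNReal.ofReal_add, ENNReal.ofReal_add]
        · ring
        all_goals linarith [h p.1, h p.2.1, h p.2.2, h (fourth p)]
    _ = 4 * S := by ring
    _ ≤ _ := by
        rw [mul_assoc, mul_assoc]
        rw [mul_assoc] at h4
        exact mul_le_mul_right h4 _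

/-- The smaller of the two weights of a pair. -/
def pairMin (q : Z2 × Z2) : ℝ := min (jb q.1) (jb q.2)

/-- The larger of the two weights of a pair. -/
def pairMax (q : Z2 × Z2) : ℝ := max (jb q.1) (jb q.2)

lemma one_le_pairMin (q : Z2 × Z2) : 1 ≤ pairMin q := le_min (one_le_jb _) (one_le_jb _)
lemma one_le_pairMax (q : Z2 × Z2) : 1 ≤ pairMax q := le_max_of_le_left (one_le_jb _)
lemma pairMin_le_pairMax (q : Z2 × Z2) : pairMin q ≤ pairMax q := min_le_max

lemma exists_tsum_pairMin_le : ∃ C : ℝ≥0, ∀ h : Z2 × Z2 → ℝ≥0∞,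
    ∑' p : Triple, h (p.1, p.2.2) *
      ENNReal.ofReal (pairMin (p.2.1, fourth p) ^ (-(3 / 4) : ℝ) / (1 + |resonance p|)) ≤
      C * ∑' q, h q := by
  obtain ⟨C, hC⟩ := exists_tsum_near_circle_le
  refine ⟨C + C, fun h => ?_⟩
  have key : ∀ n₁ n₃ : Z2, ∑' n₂ : Z2, ENNReal.ofReal
      (pairMin (n₂, fourth (n₁, n₂, n₃)) ^ (-(3 / 4) : ℝ) / (1 + |resonance (n₁, n₂, n₃)|)) ≤
      (C + C : ℝ≥0) := by
    intro n₁ n₃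
    have hsym : ∑' n₂ : Z2, ENNReal.ofReal (jb (fourth (n₁, n₂, n₃)) ^ (-(3 / 4) : ℝ) /
        (1 + |resonance (n₁, n₂, n₃)|)) ≤ C := by
      refine le_trans (le_of_eq ?_) (hC n₁ n₃)
      rw [← (Equiv.subLeft (n₁ + n₃)).tsum_eq]
      refine tsum_congr fun n => ?_
      have e1 : fourth (n₁, n₁ + n₃ - n, n₃) = n := by simp only [fourth]; abel
      have e2 : resonance (n₁, n₁ + n₃ - n, n₃) = resonance (n₁, n, n₃) := by
        rw [← resonance_flipEven, flipEven_apply, e1]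
      rw [Equiv.subLeft_apply, e1, e2]
    rw [ENNReal.coe_add]
    refine le_trans ?_ (add_le_add (hC n₁ n₃) hsym)
    rw [← ENNReal.tsum_add]
    refine ENNReal.tsum_le_tsum fun n₂ => ?_
    have h1 := jb_rpow_nonneg (-(3 / 4)) n₂
    have h2 := jb_rpow_nonneg (-(3 / 4)) (fourth (n₁, n₂, n₃))
    rw [← ENNReal.ofReal_add (by positivity) (by positivity), ← add_div]
    refine ENNReal.ofReal_le_ofReal ?_
    gcongr
    rcases min_choice (jb n₂) (jb (fourth (n₁, n₂, n₃))) with h | h <;>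
      · rw [pairMin, h]; linarith
  calc _ = ∑' n₁, ∑' n₃, ∑' n₂, h (n₁, n₃) * ENNReal.ofReal
          (pairMin (n₂, fourth (n₁, n₂, n₃)) ^ (-(3 / 4) : ℝ) /
            (1 + |resonance (n₁, n₂, n₃)|)) := by
        rw [ENNReal.tsum_prod']
        refine tsum_congr fun n₁ => ?_
        rw [ENNReal.tsum_prod', ENNReal.tsum_comm]
    _ ≤ ∑' n₁, ∑' n₃, h (n₁, n₃) * (C + C : ℝ≥0) := by
        refine ENNReal.tsum_le_tsum fun n₁ => ENNReal.tsum_le_tsum fun n₃ => ?_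
        rw [ENNReal.tsum_mul_left]
        exact mul_le_mul_right (key n₁ n₃) _
    _ = _ := by
        rw [← ENNReal.tsum_prod, ENNReal.tsum_mul_right, mul_comm]

/-- Schur test for the kernel `1 / (1 + |resonance|)` acting between the two diagonals. -/
lemma exists_schur_diagonals : ∃ C : ℝ≥0, ∀ f : Z2 × Z2 → ℝ≥0∞,
    ∑' p : Triple, ENNReal.ofReal (1 / (1 + |resonance p|)) *
      (f (p.1, p.2.2) * f (p.2.1, fourth p)) ≤
      C * ∑' q, f q ^ 2 * ENNReal.ofReal (pairMin q ^ (3 / 4 : ℝ)) := by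
  obtain ⟨C, hC⟩ := exists_tsum_pairMin_le
  refine ⟨C, fun f => ?_⟩
  set h : Z2 × Z2 → ℝ≥0∞ := fun q => f q ^ 2 * ENNReal.ofReal (pairMin q ^ (3 / 4 : ℝ))
  let K : Triple → ℝ≥0∞ := fun p => h (p.1, p.2.2) *
      ENNReal.ofReal (pairMin (p.2.1, fourth p) ^ (-(3 / 4) : ℝ) / (1 + |resonance p|))
  have hK : ∑' p, K (swapPairs p) = ∑' p, K p := swapPairs.tsum_eq K
  have := tsum_le_sqrt_mul_sqrt (h := fun p : Triple => ENNReal.ofReal (1 / (1 + |resonance p|)) *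
      (f (p.1, p.2.2) * f (p.2.1, fourth p))) (u := K) (v := fun p => K (swapPairs p)) fun p => by
    have e : K (swapPairs p) = h (p.2.1, fourth p) *
        ENNReal.ofReal (pairMin (p.1, p.2.2) ^ (-(3 / 4) : ℝ) / (1 + |resonance p|)) := by
      simp only [K]
      rw [resonance_swapPairs, fourth_swapPairs, swapPairs_apply, abs_neg]
    rw [e]
    simp only [K, h]
    set a := pairMin (p.1, p.2.2)
    set b := pairMin (p.2.1, fourth p)
    have ha : 0 < a := one_pos.trans_le (one_le_pairMin _)
    have hb : 0 < b := one_pos.trans_le (one_le_pairMin _)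
    set k := |resonance p|
    have hk : 0 ≤ k := abs_nonneg _
    have ek : ENNReal.ofReal (1 / (1 + k)) ^ 2 = ENNReal.ofReal (a ^ (3 / 4 : ℝ)) *
        ENNReal.ofReal (b ^ (-(3 / 4) : ℝ) / (1 + k)) * (ENNReal.ofReal (b ^ (3 / 4 : ℝ)) *
        ENNReal.ofReal (a ^ (-(3 / 4) : ℝ) / (1 + k))) := by
      rw [← ENNReal.ofReal_pow (by positivity), ← ENNReal.ofReal_mul (by positivity),
        ← ENNReal.ofReal_mul (by positivity), ← ENNReal.ofReal_mul (by positivity),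
        Real.rpow_neg ha.le, Real.rpow_neg hb.le]
      congr 1
      have := Real.rpow_pos_of_pos ha (3 / 4)
      have := Real.rpow_pos_of_pos hb (3 / 4)
      field_simp
    rw [mul_pow, ek]
    exact le_of_eq (by ring)
  rw [hK, sqrt_mul_self_ennreal] at this
  exact this.trans (hC h)

lemma abs_rpow_sub_le {s x y : ℝ} (hs : 1 ≤ s) (hx : 0 < x) (hy : 0 < y) :
    |x ^ s - y ^ s| ≤ s * max x y ^ (s - 1) * |x - y| := by
  wlog h : y ≤ x generalizing x y
  · rw [abs_sub_comm, abs_sub_comm x, max_comm]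
    exact this hy hx (le_of_not_ge h)
  have hB := one_add_mul_self_le_rpow_one_add (s := y / x - 1) (p := s)
    (by have := div_pos hy hx; linarith) hs
  rw [add_sub_cancel, Real.div_rpow hy.le hx.le] at hB
  have hxs := Real.rpow_pos_of_pos hx s
  rw [max_eq_left h, abs_of_nonneg
    (sub_nonneg.2 (Real.rpow_le_rpow hy.le h (by linarith))), abs_of_nonneg (sub_nonneg.2 h),
    Real.rpow_sub_one hx.ne']
  rw [le_div_iff₀ hxs] at hB
  have : s * (x ^ s / x) * (x - y) = x ^ s - (1 + s * (y / x - 1)) * x ^ s := by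
    field_simp; ring
  rw [this]; linarith

/-- The multiplier of the differentiated Sobolev norm, bounded through the two diagonals. -/
lemma abs_weightAlt_le {s : ℝ} (hs : 1 ≤ s) (p : Triple) :
    |weightAlt s p| ≤ 2 * s * max (pairMax (p.1, p.2.2)) (pairMax (p.2.1, fourth p)) ^ (s - 1) *
      (|resonance p| + max (pairMin (p.1, p.2.2)) (pairMin (p.2.1, fourth p))) := by
  have e1 : weightAlt s p = (pairMax (p.1, p.2.2) ^ s - pairMax (p.2.1, fourth p) ^ s) +
      (pairMin (p.1, p.2.2) ^ s - pairMin (p.2.1, fourth p) ^ s) := by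
    simp only [weightAlt, pairMax, pairMin]
    rcases le_total (jb p.1) (jb p.2.2) with h | h <;>
    rcases le_total (jb p.2.1) (jb (fourth p)) with h' | h' <;>
    simp only [h, h', max_eq_left, max_eq_right, min_eq_left, min_eq_right] <;> ring
  have e2 : resonance p = (pairMax (p.1, p.2.2) - pairMax (p.2.1, fourth p)) +
      (pairMin (p.1, p.2.2) - pairMin (p.2.1, fourth p)) := by
    have : resonance p = jb p.1 - jb p.2.1 + jb p.2.2 - jb (fourth p) := by
      simp only [resonance, jb]; ring
    rw [this]
    simp only [pairMax, pairMin]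
    rcases le_total (jb p.1) (jb p.2.2) with h | h <;>
    rcases le_total (jb p.2.1) (jb (fourth p)) with h' | h' <;>
    simp only [h, h', max_eq_left, max_eq_right, min_eq_left, min_eq_right] <;> ring
  have a1 := one_le_pairMin (p.1, p.2.2)
  have a2 := one_le_pairMin (p.2.1, fourth p)
  have a3 := pairMin_le_pairMax (p.1, p.2.2)
  have a4 := pairMin_le_pairMax (p.2.1, fourth p)
  rw [e1]
  set M := pairMax (p.1, p.2.2)
  set M' := pairMax (p.2.1, fourth p)
  set m := pairMin (p.1, p.2.2)
  set m' := pairMin (p.2.1, fourth p)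
  have m0 : 0 < m := by linarith
  have m0' : 0 < m' := by linarith
  have M0 : 0 < M := by linarith
  have M0' : 0 < M' := by linarith
  have s0 : 0 < s := by linarith
  have b1 := abs_rpow_sub_le hs (x := M) (y := M') (by linarith) (by linarith)
  have b2 := abs_rpow_sub_le hs (x := m) (y := m') (by linarith) (by linarith)
  have hm : |m - m'| ≤ max m m' := by
    rw [abs_le]
    constructor
    · linarith [le_max_right m m']
    · linarith [le_max_left m m']
  have hM : |M - M'| ≤ |resonance p| + max m m' := by
    have : M - M' = resonance p - (m - m') := by rw [e2]; ring
    rw [this]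
    exact (abs_sub _ _).trans (by linarith)
  have hpow : max m m' ^ (s - 1) ≤ max M M' ^ (s - 1) := by
    apply Real.rpow_le_rpow (by positivity) (max_le_max a3 a4) (by linarith)
  have hP : 0 ≤ max m m' ^ (s - 1) := by positivity
  have hres := abs_nonneg (resonance p)
  calc _ ≤ _ := abs_add_le _ _
    _ ≤ s * max M M' ^ (s - 1) * (|resonance p| + max m m') +
        s * max M M' ^ (s - 1) * (|resonance p| + max m m') := by
        refine add_le_add (b1.trans ?_) (b2.trans ?_)
        · gcongr
        · refine mul_le_mul (mul_le_mul_of_nonneg_left hpow s0.le) (by linarith)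
            (abs_nonneg _) (by positivity)
    _ = _ := by ring

lemma exists_weightAlt_div_le {s σ : ℝ} (hs : 1 < s) (hσ : σ ≤ 1 / 8) :
    ∃ C : ℝ, 0 ≤ C ∧ ∀ p : Triple, |weightAlt s p| / (1 + |resonance p|) ≤
      C * (weightSum (s - 1) p + 1 / (1 + |resonance p|) *
        ((pairMax (p.1, p.2.2) ^ ((s - σ) / 2) * pairMin (p.1, p.2.2) ^ (1 / 8 : ℝ)) *
        (pairMax (p.2.1, fourth p) ^ ((s - σ) / 2) *
          pairMin (p.2.1, fourth p) ^ (1 / 8 : ℝ)))) := by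
  refine ⟨2 * s * (3 + 16 ^ ((s - σ) / 2)), by positivity, fun p => ?_⟩
  have h := abs_weightAlt_le hs.le p
  have a1 := one_le_pairMin (p.1, p.2.2)
  have a2 := one_le_pairMin (p.2.1, fourth p)
  have a3 := pairMin_le_pairMax (p.1, p.2.2)
  have a4 := pairMin_le_pairMax (p.2.1, fourth p)
  have e2 : resonance p = (pairMax (p.1, p.2.2) - pairMax (p.2.1, fourth p)) +
      (pairMin (p.1, p.2.2) - pairMin (p.2.1, fourth p)) := by
    have : resonance p = jb p.1 - jb p.2.1 + jb p.2.2 - jb (fourth p) := by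
      simp only [resonance, jb]; ring
    rw [this]
    simp only [pairMax, pairMin]
    rcases le_total (jb p.1) (jb p.2.2) with h | h <;>
    rcases le_total (jb p.2.1) (jb (fourth p)) with h' | h' <;>
    simp only [h, h', max_eq_left, max_eq_right, min_eq_left, min_eq_right] <;> ring
  have hW : max (pairMax (p.1, p.2.2)) (pairMax (p.2.1, fourth p)) ^ (s - 1) ≤
      weightSum (s - 1) p := by
    have h := jb_rpow_nonneg (s - 1)
    have g1 := h p.1
    have g2 := h p.2.1
    have g3 := h p.2.2
    have g4 := h (fourth p)
    simp only [pairMax, weightSum]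
    rcases max_choice (max (jb p.1) (jb p.2.2)) (max (jb p.2.1) (jb (fourth p))) with h | h
    · rw [h]
      rcases max_choice (jb p.1) (jb p.2.2) with h | h <;> rw [h] <;> linarith
    · rw [h]
      rcases max_choice (jb p.2.1) (jb (fourth p)) with h | h <;> rw [h] <;> linarith
  set M := pairMax (p.1, p.2.2)
  set M' := pairMax (p.2.1, fourth p)
  set m := pairMin (p.1, p.2.2)
  set m' := pairMin (p.2.1, fourth p)
  have m0 : 0 < m := by linarith
  have m0' : 0 < m' := by linarith
  have M0 : 0 < M := by linarith
  have M0' : 0 < M' := by linarith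
  have s0 : 0 < s := by linarith
  set ω := |resonance p|
  have hω : 0 ≤ ω := abs_nonneg _
  set X := max M M'
  have hX : 1 ≤ X := le_max_of_le_left (by linarith)
  set x := max m m'
  have hx1 : 1 ≤ x := le_max_of_le_left a1
  have hxX : x ≤ X := max_le_max a3 a4
  set Q := M ^ ((s - σ) / 2) * m ^ (1 / 8 : ℝ) * (M' ^ ((s - σ) / 2) * m' ^ (1 / 8 : ℝ))
  have hQ : 0 ≤ Q := by positivity
  have hXs : 0 ≤ X ^ (s - 1) := by positivity
  set D : ℝ := 16 ^ ((s - σ) / 2)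
  have hD : 0 ≤ D := by positivity
  -- either the two diagonals have comparable maxima or the resonance function is large
  have key : X ^ (s - 1) * x ≤ D * Q + 2 * X ^ (s - 1) * (1 + ω) := by
    by_cases hc : X ≤ 16 * min M M'
    · have hMM : X ^ 2 / 16 ≤ M * M' := by
        rw [← max_mul_min M M']; change X ^ 2 / 16 ≤ X * min M M'
        nlinarith
      have hmm : x ≤ m * m' := by
        rcases max_choice m m' with h | h <;> simp only [x, h] <;> nlinarith
      have : X ^ (s - 1) * x ≤ D * Q := by
        have e : D * Q = (16 * (M * M')) ^ ((s - σ) / 2) * (m * m') ^ (1 / 8 : ℝ) := by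
          simp only [D, Q]
          rw [Real.mul_rpow (by norm_num) (by positivity),
            Real.mul_rpow (by positivity) (by positivity),
            Real.mul_rpow (x := m) (by positivity) (by positivity)]
          ring
        rw [e]
        calc X ^ (s - 1) * x = X ^ (s - 1) * (x ^ (7 / 8 : ℝ) * x ^ (1 / 8 : ℝ)) := by
              rw [← Real.rpow_add (by positivity)]; norm_num
          _ ≤ X ^ (s - 1) * (X ^ (1 - σ) * x ^ (1 / 8 : ℝ)) := by
              gcongr
              calc x ^ (7 / 8 : ℝ) ≤ X ^ (7 / 8 : ℝ) := by gcongr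
                _ ≤ X ^ (1 - σ) := Real.rpow_le_rpow_of_exponent_le hX (by linarith)
          _ = (X ^ 2) ^ ((s - σ) / 2) * x ^ (1 / 8 : ℝ) := by
              rw [← mul_assoc, ← Real.rpow_add (by positivity), ← Real.rpow_two,
                ← Real.rpow_mul (by positivity)]
              ring_nf
          _ ≤ _ := by
              have : 0 ≤ (s - σ) / 2 := by linarith
              gcongr
              linarith
      have : 0 ≤ 2 * X ^ (s - 1) * (1 + ω) := by positivity
      linarith
    · push Not at hc
      have hωX : X ≤ 2 * ω := by
        simp only [ω]
        rw [e2]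
        rcases le_total M M' with hMM | hMM
        · have hX' : X = M' := max_eq_right hMM
          rw [min_eq_left hMM] at hc
          have := neg_le_abs (M - M' + (m - m'))
          linarith
        · have hX' : X = M := max_eq_left hMM
          rw [min_eq_right hMM] at hc
          have := le_abs_self (M - M' + (m - m'))
          linarith
      have : X ^ (s - 1) * x ≤ X ^ (s - 1) * (2 * (1 + ω)) := by gcongr; linarith
      have : 0 ≤ D * Q := by positivity
      linarith
  rw [div_le_iff₀ (by positivity)]
  refine h.trans ?_
  have e3 : 2 * s * (3 + D) * (weightSum (s - 1) p + 1 / (1 + ω) * Q) * (1 + ω) =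
      2 * s * ((3 + D) * weightSum (s - 1) p * (1 + ω) + (3 + D) * Q) := by field_simp
  rw [e3, mul_assoc]
  gcongr
  have : 0 ≤ D * (weightSum (s - 1) p * (1 + ω)) := by
    have := weightSum_nonneg (s - 1) p; positivity
  have : X ^ (s - 1) * (1 + ω) ≤ weightSum (s - 1) p * (1 + ω) := by gcongr
  nlinarith

lemma tsum_pair_le (r : ℝ) (c : Z2 → ℝ≥0∞) :
    ∑' q : Z2 × Z2, (ENNReal.ofReal (pairMax q ^ (r / 2) * pairMin q ^ (1 / 8 : ℝ)) *
      (c q.1 * c q.2)) ^ 2 * ENNReal.ofReal (pairMin q ^ (3 / 4 : ℝ)) ≤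
      2 * (sobolevE r c * sobolevE 1 c) := by
  have e : sobolevE r c * sobolevE 1 c = ∑' q : Z2 × Z2,
      (ENNReal.ofReal (jb q.1 ^ r) * c q.1 ^ 2) *
        (ENNReal.ofReal (jb q.2 ^ (1 : ℝ)) * c q.2 ^ 2) := by
    rw [ENNReal.tsum_prod', sobolevE, ← ENNReal.tsum_mul_right]
    simp only [ENNReal.tsum_mul_left]; rfl
  have e' : sobolevE r c * sobolevE 1 c = ∑' q : Z2 × Z2,
      (ENNReal.ofReal (jb q.2 ^ r) * c q.2 ^ 2) *
        (ENNReal.ofReal (jb q.1 ^ (1 : ℝ)) * c q.1 ^ 2) := by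
    rw [e, ← (Equiv.prodComm Z2 Z2).tsum_eq]; rfl
  rw [two_mul]
  nth_rw 1 [e]
  rw [e', ← ENNReal.tsum_add]
  refine ENNReal.tsum_le_tsum fun q => ?_
  have h1 := jb_pos q.1
  have h2 := jb_pos q.2
  have hm : 0 < pairMin q := one_pos.trans_le (one_le_pairMin q)
  have hM : 0 < pairMax q := one_pos.trans_le (one_le_pairMax q)
  have e3 : (pairMax q ^ (r / 2) * pairMin q ^ (1 / 8 : ℝ)) ^ 2 * pairMin q ^ (3 / 4 : ℝ) =
      pairMax q ^ r * pairMin q ^ (1 : ℝ) := by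
    rw [mul_pow, ← Real.rpow_mul_natCast hM.le, ← Real.rpow_mul_natCast hm.le, mul_assoc,
      ← Real.rpow_add hm]
    norm_num
  calc _ = ENNReal.ofReal (pairMax q ^ r * pairMin q ^ (1 : ℝ)) * (c q.1 ^ 2 * c q.2 ^ 2) := by
        rw [← e3, ENNReal.ofReal_mul (p := (pairMax q ^ (r / 2) * pairMin q ^ (1 / 8 : ℝ)) ^ 2)
          (by positivity), ENNReal.ofReal_pow (by positivity)]
        ring
    _ ≤ ENNReal.ofReal (jb q.1 ^ r * jb q.2 ^ (1 : ℝ) + jb q.2 ^ r * jb q.1 ^ (1 : ℝ)) *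
        (c q.1 ^ 2 * c q.2 ^ 2) := by
        gcongr
        simp only [pairMax, pairMin]
        have i1 : 0 ≤ jb q.1 ^ r * jb q.2 ^ (1 : ℝ) := by positivity
        have i2 : 0 ≤ jb q.2 ^ r * jb q.1 ^ (1 : ℝ) := by positivity
        rcases le_total (jb q.1) (jb q.2) with h | h
        · rw [max_eq_right h, min_eq_left h]; linarith
        · rw [max_eq_left h, min_eq_right h]; linarith
    _ = _ := by
        rw [ENNReal.ofReal_add (by positivity) (by positivity), ENNReal.ofReal_mul (by positivity),
          ENNReal.ofReal_mul (by positivity)]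
        ring

/-- The quartic estimate: after dividing by the resonance function, the multiplier of the
differentiated `H^s` norm loses `2σ` derivatives. -/
lemma exists_quartic_le {s σ ε : ℝ} (hs : 1 < s) (hσ : σ ≤ 1 / 8)
    (hε : 0 < ε) : ∃ C : ℝ≥0, ∀ c : Z2 → ℝ≥0∞,
      ∑' p, ENNReal.ofReal (|weightAlt s p| / (1 + |resonance p|)) * prod4 c p ≤
        C * (sobolevE (s - σ) c * sobolevE (1 + ε) c) := by
  obtain ⟨A, hA0, hA⟩ := exists_weightAlt_div_le hs hσ
  obtain ⟨B, hB⟩ := exists_tsum_weightSum_le (r := s - 1) (by linarith)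
  obtain ⟨L, hL⟩ := tsum_sq_le hε
  obtain ⟨D, hD⟩ := exists_schur_diagonals
  refine ⟨A.toNNReal * (B * L + D * 2), fun c => ?_⟩
  set f : Z2 × Z2 → ℝ≥0∞ := fun q =>
    ENNReal.ofReal (pairMax q ^ ((s - σ) / 2) * pairMin q ^ (1 / 8 : ℝ)) * (c q.1 * c q.2)
  have h1 : ∑' p, ENNReal.ofReal (weightSum (s - 1) p) * prod4 c p ≤
      (B * L : ℝ≥0) * (sobolevE (s - σ) c * sobolevE (1 + ε) c) := by
    refine (hB c).trans ?_
    calc _ ≤ B * (L * sobolevE (1 + ε) c) * sobolevE (s - σ) c := by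
          gcongr
          · exact hL c
          · exact sobolevE_mono (by linarith) c
      _ = _ := by rw [ENNReal.coe_mul]; ring
  have h2 : ∑' p : Triple, ENNReal.ofReal (1 / (1 + |resonance p|)) *
      (f (p.1, p.2.2) * f (p.2.1, fourth p)) ≤
      (D * 2 : ℝ≥0) * (sobolevE (s - σ) c * sobolevE (1 + ε) c) := by
    refine (hD f).trans ?_
    rw [ENNReal.coe_mul, mul_assoc]
    refine mul_le_mul_right ((tsum_pair_le (s - σ) c).trans ?_) _
    refine mul_le_mul_right (mul_le_mul_right (sobolevE_mono (by linarith) c) _) _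
  calc _ ≤ ∑' p, ENNReal.ofReal A * (ENNReal.ofReal (weightSum (s - 1) p) * prod4 c p +
        ENNReal.ofReal (1 / (1 + |resonance p|)) *
          (f (p.1, p.2.2) * f (p.2.1, fourth p))) := by
        refine ENNReal.tsum_le_tsum fun p => ?_
        refine (mul_le_mul_left (ENNReal.ofReal_le_ofReal (hA p)) _).trans (le_of_eq ?_)
        have i1 : 0 < pairMin (p.1, p.2.2) := one_pos.trans_le (one_le_pairMin _)
        have i2 : 0 < pairMin (p.2.1, fourth p) := one_pos.trans_le (one_le_pairMin _)
        have i3 : 0 < pairMax (p.1, p.2.2) := one_pos.trans_le (one_le_pairMax _)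
        have i4 : 0 < pairMax (p.2.1, fourth p) := one_pos.trans_le (one_le_pairMax _)
        have i5 := weightSum_nonneg (s - 1) p
        rw [ENNReal.ofReal_mul hA0, ENNReal.ofReal_add i5 (by positivity),
          ENNReal.ofReal_mul (by positivity),
          ENNReal.ofReal_mul (p := pairMax (p.1, p.2.2) ^ ((s - σ) / 2) * _) (by positivity)]
        simp only [f, prod4]
        ring
    _ ≤ _ := by
        rw [ENNReal.tsum_mul_left, ENNReal.tsum_add]
        refine (mul_le_mul_right (add_le_add h1 h2) _).trans (le_of_eq ?_)
        rw [← add_mul, ← ENNReal.coe_add, ENNReal.coe_mul, mul_assoc]; rfl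

/-- The sum of the four products obtained from `prod4 c` by replacing one factor by the
trilinear convolution of `c`. -/
def sixProd (c : Z2 → ℝ≥0∞) (p : Triple) : ℝ≥0∞ :=
  conv3 c p.1 * c p.2.1 * c p.2.2 * c (fourth p) +
    c p.1 * conv3 c p.2.1 * c p.2.2 * c (fourth p) +
    c p.1 * c p.2.1 * conv3 c p.2.2 * c (fourth p) +
    c p.1 * c p.2.1 * c p.2.2 * conv3 c (fourth p)

/-- A sequence dominating both `c` and its trilinear convolution, the latter normalized. -/
def augment (c : Z2 → ℝ≥0∞) (n : Z2) : ℝ≥0∞ := c n + ((∑' n, c n) ^ 2)⁻¹ * conv3 c n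

lemma sobolevE_add_le (r : ℝ) (c d : Z2 → ℝ≥0∞) :
    sobolevE r (fun n => c n + d n) ≤ 2 * sobolevE r c + 2 * sobolevE r d := by
  simp only [sobolevE]
  rw [← ENNReal.tsum_mul_left, ← ENNReal.tsum_mul_left, ← ENNReal.tsum_add]
  refine ENNReal.tsum_le_tsum fun n => ?_
  have h : (c n + d n) ^ 2 ≤ 2 * c n ^ 2 + 2 * d n ^ 2 := by
    rw [← mul_add, ← ENNReal.rpow_natCast, ← ENNReal.rpow_natCast, ← ENNReal.rpow_natCast]
    have := ENNReal.rpow_add_le_mul_rpow_add_rpow (c n) (d n) (p := (2 : ℕ)) (by norm_num)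
    refine this.trans (le_of_eq ?_)
    norm_num
  calc _ ≤ ENNReal.ofReal (jb n ^ r) * (2 * c n ^ 2 + 2 * d n ^ 2) := by gcongr
    _ = _ := by ring

lemma sobolevE_const_mul (r : ℝ) (k : ℝ≥0∞) (c : Z2 → ℝ≥0∞) :
    sobolevE r (fun n => k * c n) = k ^ 2 * sobolevE r c := by
  simp only [sobolevE]
  rw [← ENNReal.tsum_mul_left]
  exact tsum_congr fun n => by ring

lemma exists_sobolevE_augment_le {r : ℝ} (hr : 0 ≤ r) : ∃ C : ℝ≥0, ∀ c : Z2 → ℝ≥0∞,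
    sobolevE r (augment c) ≤ C * sobolevE r c := by
  refine ⟨2 + 2 * (9 * 9 ^ r : ℝ).toNNReal, fun c => ?_⟩
  refine (sobolevE_add_le r c _).trans ?_
  rw [sobolevE_const_mul, ENNReal.coe_add, add_mul]
  refine add_le_add le_rfl ?_
  rw [ENNReal.coe_mul, mul_assoc]
  refine mul_le_mul_right ?_ 2
  set ℓ := ∑' n, c n
  calc _ ≤ (ℓ ^ 2)⁻¹ ^ 2 * (ENNReal.ofReal (9 * 9 ^ r) * ℓ ^ 4 * sobolevE r c) := by
        gcongr; exact sobolevE_conv3_le hr c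
    _ = ((ℓ ^ 4)⁻¹ * ℓ ^ 4) * (ENNReal.ofReal (9 * 9 ^ r) * sobolevE r c) := by
        rw [show (ℓ ^ 4)⁻¹ = (ℓ ^ 2)⁻¹ ^ 2 by rw [← ENNReal.inv_pow, ← pow_mul]]; ring
    _ ≤ 1 * (ENNReal.ofReal (9 * 9 ^ r) * sobolevE r c) := by
        gcongr; exact ENNReal.inv_mul_le_one _
    _ = _ := one_mul _

lemma sixProd_le {c : Z2 → ℝ≥0∞} (hc : ∑' n, c n ≠ ∞) (p : Triple) :
    sixProd c p ≤ 4 * (∑' n, c n) ^ 2 * prod4 (augment c) p := by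
  set ℓ := ∑' n, c n with hℓ
  have h1 : ∀ n, c n ≤ augment c n := fun n => le_self_add
  have h2 : ∀ n, conv3 c n ≤ ℓ ^ 2 * augment c n := by
    intro n
    by_cases h0 : ℓ = 0
    · have hc0 : ∀ n, c n = 0 := ENNReal.tsum_eq_zero.1 h0
      simp [conv3, hc0]
    · rw [augment, mul_add, ← mul_assoc, ENNReal.mul_inv_cancel (by simpa using h0)
        (ENNReal.pow_ne_top hc), one_mul]
      exact le_add_self
  have h3 : 4 * ℓ ^ 2 * prod4 (augment c) p =
      (ℓ ^ 2 * augment c p.1) * augment c p.2.1 * augment c p.2.2 * augment c (fourth p) +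
      augment c p.1 * (ℓ ^ 2 * augment c p.2.1) * augment c p.2.2 * augment c (fourth p) +
      augment c p.1 * augment c p.2.1 * (ℓ ^ 2 * augment c p.2.2) * augment c (fourth p) +
      augment c p.1 * augment c p.2.1 * augment c p.2.2 * (ℓ ^ 2 * augment c (fourth p)) := by
    rw [prod4]; ring
  rw [h3, sixProd]
  gcongr <;> first | exact h1 _ | exact h2 _

lemma tsum_mul_sixProd_le {c : Z2 → ℝ≥0∞} (hc : ∑' n, c n ≠ ∞) (W : Triple → ℝ≥0∞) :
    ∑' p, W p * sixProd c p ≤ 4 * (∑' n, c n) ^ 2 * ∑' p, W p * prod4 (augment c) p := by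
  rw [← ENNReal.tsum_mul_left]
  refine ENNReal.tsum_le_tsum fun p => ?_
  refine (mul_le_mul_right (sixProd_le hc p) _).trans (le_of_eq (by ring))

lemma tsum_ne_top_of_sobolevE {ε : ℝ} (hε : 0 < ε) {c : Z2 → ℝ≥0∞}
    (hc : sobolevE (1 + ε) c ≠ ∞) : ∑' n, c n ≠ ∞ := by
  obtain ⟨L, hL⟩ := tsum_sq_le hε
  intro h
  have := hL c
  rw [h, ENNReal.top_pow (by norm_num), top_le_iff] at this
  exact ENNReal.mul_ne_top ENNReal.coe_ne_top hc this

lemma sobolevE_interpolate {r s θ : ℝ} (h0 : 0 ≤ θ) (h1 : θ ≤ 1) (c : Z2 → ℝ≥0∞) :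
    sobolevE ((1 - θ) * r + θ * s) c ≤ sobolevE r c ^ (1 - θ) * sobolevE s c ^ θ := by
  have := ENNReal.lintegral_mul_norm_pow_le (μ := (Measure.count : Measure Z2))
    (f := fun n => ENNReal.ofReal (jb n ^ r) * c n ^ 2)
    (g := fun n => ENNReal.ofReal (jb n ^ s) * c n ^ 2)
    (measurable_of_countable _).aemeasurable (measurable_of_countable _).aemeasurable
    (p := 1 - θ) (q := θ) (by linarith) h0 (by ring)
  simp only [MeasureTheory.lintegral_count] at this
  refine le_trans (le_of_eq (tsum_congr fun n => ?_)) this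
  have hj := jb_pos n
  rw [ENNReal.mul_rpow_of_nonneg _ _ (by linarith), ENNReal.mul_rpow_of_nonneg _ _ h0,
    ENNReal.ofReal_rpow_of_pos (by positivity), ENNReal.ofReal_rpow_of_pos (by positivity),
    ← Real.rpow_mul hj.le, ← Real.rpow_mul hj.le]
  calc _ = ENNReal.ofReal (jb n ^ (r * (1 - θ)) * jb n ^ (s * θ)) *
        ((c n ^ 2) ^ (1 - θ) * (c n ^ 2) ^ θ) := by
        rw [← Real.rpow_add hj, ← ENNReal.rpow_add_of_nonneg _ _ (by linarith) h0]
        ring_nf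
        simp
    _ = _ := by rw [ENNReal.ofReal_mul (by positivity)]; ring

lemma sobolevE_le_of_le {s θ K S : ℝ} (h0 : 0 ≤ θ) (h1 : θ ≤ 1) (hK : 1 ≤ K) (hS : 1 ≤ S)
    {c : Z2 → ℝ≥0∞} (hcK : sobolevE 1 c ≤ ENNReal.ofReal K)
    (hcS : sobolevE s c ≤ ENNReal.ofReal S) :
    sobolevE ((1 - θ) + θ * s) c ≤ ENNReal.ofReal (K * S ^ θ) := by
  have h := sobolevE_interpolate (r := 1) (s := s) h0 h1 c
  rw [mul_one] at h
  refine h.trans ?_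
  rw [ENNReal.ofReal_mul (by linarith), ← ENNReal.ofReal_rpow_of_pos (by linarith)]
  gcongr
  refine (ENNReal.rpow_le_rpow hcK (by linarith)).trans ?_
  rw [ENNReal.ofReal_rpow_of_pos (by linarith)]
  refine ENNReal.ofReal_le_ofReal ?_
  calc K ^ (1 - θ) ≤ K ^ (1 : ℝ) := Real.rpow_le_rpow_of_exponent_le hK (by linarith)
    _ = K := Real.rpow_one K

/-- The multilinear estimates driving the growth bound: both the quartic and the sextic forms
weighted by `|weightAlt s| / (1 + |resonance|)` gain a power of the top norm. -/
lemma exists_modified_energy_le {s : ℝ} (hs : 1 < s) : ∃ γ C : ℝ, 0 < γ ∧ γ ≤ 1 ∧ 0 ≤ C ∧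
    ∀ (c : Z2 → ℝ≥0∞) (K S : ℝ), 1 ≤ K → 1 ≤ S → sobolevE 1 c ≤ ENNReal.ofReal K →
      sobolevE s c ≤ ENNReal.ofReal S →
      ∑' p, ENNReal.ofReal (|weightAlt s p| / (1 + |resonance p|)) * (prod4 c p + sixProd c p) ≤
        ENNReal.ofReal (C * K ^ 3 * S ^ (1 - γ)) := by
  set σ := min (1 / 8) ((s - 1) / 2)
  have hσ0 : 0 < σ := lt_min (by norm_num) (by linarith)
  have hσ1 : σ ≤ 1 / 8 := min_le_left _ _
  have hσ2 : σ ≤ (s - 1) / 2 := min_le_right _ _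
  set l := σ / (s - 1) with hl
  have hs1 : 0 < s - 1 := by linarith
  have hl0 : 0 < l := by positivity
  have hlσ : l * (s - 1) = σ := by rw [hl]; field_simp
  have hl1 : l ≤ 1 / 2 := by rw [hl, div_le_iff₀ hs1]; linarith
  obtain ⟨Q, hQ⟩ := exists_quartic_le (ε := σ / 4) hs hσ1 (by positivity)
  obtain ⟨L, hL⟩ := tsum_sq_le (ε := σ / 4) (by positivity)
  obtain ⟨A, hA⟩ := exists_sobolevE_augment_le (r := s - σ) (by linarith)
  obtain ⟨B, hB⟩ := exists_sobolevE_augment_le (r := 1 + σ / 4) (by linarith)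
  refine ⟨l / 2, Q + 4 * L * Q * A * B, by positivity, by linarith, by positivity,
    fun c K S hK hS hcK hcS => ?_⟩
  have i1 : sobolevE (s - σ) c ≤ ENNReal.ofReal (K * S ^ (1 - l)) := by
    have := sobolevE_le_of_le (θ := 1 - l) (by linarith) (by linarith) hK hS hcK hcS
    convert this using 2
    rw [← hlσ]; ring
  have i2 : sobolevE (1 + σ / 4) c ≤ ENNReal.ofReal (K * S ^ (l / 4)) := by
    have := sobolevE_le_of_le (θ := l / 4) (by linarith) (by linarith) hK hS hcK hcS
    convert this using 2
    rw [← hlσ]; ring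
  have hfin : ∑' n, c n ≠ ∞ := tsum_ne_top_of_sobolevE (ε := σ / 4) (by positivity)
    (i2.trans_lt ENNReal.ofReal_lt_top).ne
  obtain ⟨X, hXe⟩ : ∃ X, X = K * S ^ (1 - l) := ⟨_, rfl⟩
  obtain ⟨Y, hYe⟩ : ∃ Y, Y = K * S ^ (l / 4) := ⟨_, rfl⟩
  rw [← hXe] at i1
  rw [← hYe] at i2
  have hX : 0 ≤ X := by rw [hXe]; positivity
  have hY : 0 ≤ Y := by rw [hYe]; positivity
  have q1 : ∑' p, ENNReal.ofReal (|weightAlt s p| / (1 + |resonance p|)) * prod4 c p ≤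
      ENNReal.ofReal (Q * (X * Y)) := by
    refine (hQ c).trans ?_
    rw [ENNReal.ofReal_mul (by positivity), ENNReal.ofReal_mul hX, ENNReal.ofReal_coe_nnreal]
    gcongr
  have q2 : ∑' p, ENNReal.ofReal (|weightAlt s p| / (1 + |resonance p|)) * sixProd c p ≤
      ENNReal.ofReal (4 * (L * Y) * (Q * ((A * X) * (B * Y)))) := by
    refine (tsum_mul_sixProd_le hfin _).trans ?_
    rw [ENNReal.ofReal_mul (by positivity), ENNReal.ofReal_mul (by positivity),
      ENNReal.ofReal_mul (by positivity), ENNReal.ofReal_mul (by positivity),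
      ENNReal.ofReal_mul (p := A * X) (by positivity), ENNReal.ofReal_mul (by positivity),
      ENNReal.ofReal_mul (by positivity), ENNReal.ofReal_coe_nnreal, ENNReal.ofReal_coe_nnreal,
      ENNReal.ofReal_coe_nnreal, ENNReal.ofReal_coe_nnreal]
    refine mul_le_mul' (mul_le_mul' (by simp) ((hL c).trans (by gcongr)))
      ((hQ _).trans ?_)
    gcongr
    · exact (hA c).trans (by gcongr)
    · exact (hB c).trans (by gcongr)
  simp only [mul_add]
  rw [ENNReal.tsum_add]
  refine (add_le_add q1 q2).trans ?_
  rw [← ENNReal.ofReal_add (by positivity) (by positivity)]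
  refine ENNReal.ofReal_le_ofReal ?_
  have hS0 : 0 < S := by linarith
  have r1 : X * Y ≤ K ^ 3 * S ^ (1 - l / 2) := by
    have e : X * Y = K ^ 2 * S ^ (1 - l + l / 4) := by
      rw [Real.rpow_add hS0, hXe, hYe]; ring
    rw [e]
    gcongr ?_ * ?_
    · exact pow_le_pow_right₀ hK (by norm_num)
    · exact Real.rpow_le_rpow_of_exponent_le hS (by linarith)
  have r2 : Y * (X * Y) = K ^ 3 * S ^ (1 - l / 2) := by
    have e : 1 - l / 2 = l / 4 + (1 - l + l / 4) := by ring
    rw [e, Real.rpow_add hS0, Real.rpow_add hS0, hXe, hYe]; ring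
  calc _ = Q * (X * Y) + 4 * L * Q * A * B * (Y * (X * Y)) := by ring
    _ ≤ Q * (K ^ 3 * S ^ (1 - l / 2)) + 4 * L * Q * A * B * (K ^ 3 * S ^ (1 - l / 2)) := by
        rw [r2]; gcongr
    _ = _ := by ring

/-- Absolute convergence of all quartic and sextic forms in `H^s`, `s > 1`. -/
lemma exists_tsum_weightSum_prod_le {s : ℝ} (hs : 1 < s) : ∃ C : ℝ≥0, ∀ (c : Z2 → ℝ≥0∞) (S : ℝ≥0),
    sobolevE s c ≤ S →
      ∑' p, ENNReal.ofReal (weightSum s p) * (prod4 c p + sixProd c p) ≤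
        (C * (S ^ 2 + S ^ 3) : ℝ≥0) := by
  obtain ⟨L, hL⟩ := tsum_sq_le (ε := s - 1) (by linarith)
  rw [add_sub_cancel] at hL
  obtain ⟨W, hW⟩ := exists_tsum_weightSum_le (r := s) (by linarith)
  obtain ⟨A, hA⟩ := exists_sobolevE_augment_le (r := s) (by linarith)
  refine ⟨W * L + 4 * L * W * L * A * A, fun c S hS => ?_⟩
  have hfin : ∑' n, c n ≠ ∞ := tsum_ne_top_of_sobolevE (ε := s - 1) (by linarith)
    (by rw [add_sub_cancel]; exact (hS.trans_lt ENNReal.coe_lt_top).ne)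
  have hW' : ∀ c, ∑' p, ENNReal.ofReal (weightSum s p) * prod4 c p ≤
      W * (L * sobolevE s c) * sobolevE s c := fun c => (hW c).trans (by gcongr; exact hL c)
  have q1 := (hW' c).trans (show _ ≤ W * (L * (S : ℝ≥0∞)) * S by gcongr)
  have q2 : ∑' p, ENNReal.ofReal (weightSum s p) * sixProd c p ≤
      4 * (L * S) * (W * (L * (A * S)) * (A * S)) := by
    refine (tsum_mul_sixProd_le hfin _).trans ?_
    have hA' : sobolevE s (augment c) ≤ A * S := (hA c).trans (by gcongr)
    refine mul_le_mul' (mul_le_mul' le_rfl ((hL c).trans (by gcongr))) ((hW' _).trans ?_)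
    gcongr
  simp only [mul_add]
  rw [ENNReal.tsum_add]
  refine (add_le_add q1 q2).trans ?_
  norm_cast
  calc _ = W * L * S ^ 2 + 4 * L * W * L * A * A * S ^ 3 := by ring
    _ ≤ (W * L + 4 * L * W * L * A * A) * S ^ 2 + (W * L + 4 * L * W * L * A * A) * S ^ 3 := by
        gcongr
        · exact le_self_add
        · exact le_add_self

/-! ### Termwise integration of derivatives -/

lemma norm_tsum_sub_tsum_le {ι : Type*} [Countable ι] {f f' : ι → ℝ → ℂ}
    (hd : ∀ i t, HasDerivAt (f i) (f' i t) t) {x y D : ℝ} (hxy : x ≤ y) {A : ℝ≥0}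
    (hA : ∀ t ∈ Icc x y, ∑' i, ‖f' i t‖ₑ ≤ A) (hx : Summable fun i => f i x)
    (hy : Summable fun i => f i y) (hD : ∀ t ∈ Icc x y, ‖∑' i, f' i t‖ ≤ D) :
    ‖∑' i, f i y - ∑' i, f i x‖ ≤ D * (y - x) := by
  have hm : ∀ i, AEStronglyMeasurable (f' i) (volume.restrict (Ioc x y)) := fun i => by
    have : f' i = deriv (f i) := funext fun t => (hd i t).deriv.symm
    rw [this]
    exact aestronglyMeasurable_deriv _ _
  have hfin : ∑' i, ∫⁻ t in Ioc x y, ‖f' i t‖ₑ ≠ ∞ := by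
    rw [← lintegral_tsum fun i => (hm i).enorm]
    refine ((setLIntegral_mono' measurableSet_Ioc
      fun t ht => hA t (Ioc_subset_Icc_self ht)).trans_lt ?_).ne
    rw [setLIntegral_const]
    exact ENNReal.mul_lt_top ENNReal.coe_lt_top measure_Ioc_lt_top
  have hi : ∀ i, ∫ t in Ioc x y, f' i t = f i y - f i x := fun i => by
    rw [← intervalIntegral.integral_of_le hxy]
    refine intervalIntegral.integral_eq_sub_of_hasDerivAt (fun t _ => hd i t) ?_
    rw [intervalIntegrable_iff_integrableOn_Ioc_of_le hxy]
    exact ⟨hm i, ((ENNReal.le_tsum i).trans_lt hfin.lt_top)⟩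
  have hsum : ∫ t in Ioc x y, ∑' i, f' i t = ∑' i, f i y - ∑' i, f i x := by
    rw [integral_tsum hm hfin, ← hy.tsum_sub hx]
    exact tsum_congr hi
  rw [← hsum]
  refine (norm_setIntegral_le_of_norm_le_const measure_Ioc_lt_top
    fun t ht => hD t (Ioc_subset_Icc_self ht)).trans (le_of_eq ?_)
  simp [Measure.real, hxy]

lemma norm_tsum_add_tsum_sub_le {ι κ : Type*} [Countable ι] [Countable κ]
    {f f' : ι → ℝ → ℂ} {g g' : κ → ℝ → ℂ}
    (hf : ∀ i t, HasDerivAt (f i) (f' i t) t) (hg : ∀ i t, HasDerivAt (g i) (g' i t) t)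
    {x y D : ℝ} (hxy : x ≤ y) {A B : ℝ≥0}
    (hA : ∀ t ∈ Icc x y, ∑' i, ‖f' i t‖ₑ ≤ A) (hB : ∀ t ∈ Icc x y, ∑' i, ‖g' i t‖ₑ ≤ B)
    (hfs : ∀ t ∈ Icc x y, Summable fun i => f i t) (hgs : ∀ t ∈ Icc x y, Summable fun i => g i t)
    (hD : ∀ t ∈ Icc x y, ‖∑' i, f' i t + ∑' i, g' i t‖ ≤ D) :
    ‖(∑' i, f i y + ∑' i, g i y) - (∑' i, f i x + ∑' i, g i x)‖ ≤ D * (y - x) := by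
  have key : ∀ (u : ι → ℂ) (v : κ → ℂ), Summable u → Summable v →
      Summable (Sum.elim u v) ∧ ∑' i, Sum.elim u v i = ∑' i, u i + ∑' i, v i := by
    intro u v hu hv
    have := HasSum.sum (f := Sum.elim u v) hu.hasSum hv.hasSum
    exact ⟨this.summable, this.tsum_eq⟩
  have hAB : ∀ t ∈ Icc x y, ∑' i, ‖Sum.elim (fun i => f' i t) (fun i => g' i t) i‖ₑ ≤
      (A + B : ℝ≥0) := fun t ht => by
    rw [Summable.tsum_sum ENNReal.summable ENNReal.summable, ENNReal.coe_add]
    exact add_le_add (hA t ht) (hB t ht)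
  have e : ∀ (u : ι → ℝ → ℂ) (v : κ → ℝ → ℂ) (t : ℝ) (i : ι ⊕ κ),
      Sum.elim u v i t = Sum.elim (fun i => u i t) (fun i => v i t) i := by
    rintro u v t (i | i) <;> rfl
  have hx : x ∈ Icc x y := left_mem_Icc.2 hxy
  have hy : y ∈ Icc x y := right_mem_Icc.2 hxy
  have := norm_tsum_sub_tsum_le (f := Sum.elim f g) (f' := Sum.elim f' g') (A := A + B) (D := D)
    (by rintro (i | i) t <;> [exact hf i t; exact hg i t]) hxy
    (fun t ht => by simp only [e]; exact hAB t ht)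
    (by simp only [e]; exact (key _ _ (hfs x hx) (hgs x hx)).1)
    (by simp only [e]; exact (key _ _ (hfs y hy) (hgs y hy)).1)
    (fun t ht => by
      simp only [e]
      rw [(key _ _ (Summable.of_enorm (ne_top_of_le_ne_top ENNReal.coe_ne_top (hA t ht)))
        (Summable.of_enorm (ne_top_of_le_ne_top ENNReal.coe_ne_top (hB t ht)))).2]
      exact hD t ht)
  simp only [e] at this
  rwa [(key _ _ (hfs x hx) (hgs x hx)).2, (key _ _ (hfs y hy) (hgs y hy)).2] at this

/-! ### Quartic and sextic forms -/

/-- The cubic nonlinearity on the Fourier side. -/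
def cubicSum (a : Z2 → ℂ) (n : Z2) : ℂ :=
  ∑' p : {p : Triple // p.1 - p.2.1 + p.2.2 = n}, cubicTerm a p.1

/-- The quartic monomial attached to a quadruple. -/
def quad (a : Z2 → ℂ) (p : Triple) : ℂ :=
  a p.1 * conj (a p.2.1) * a p.2.2 * conj (a (fourth p))

/-- The contribution of the nonlinearity to the time derivative of `quad`. -/
def six (a : Z2 → ℂ) (p : Triple) : ℂ :=
  Complex.I * (cubicSum a p.1 * conj (a p.2.1) * a p.2.2 * conj (a (fourth p)) -
    a p.1 * conj (cubicSum a p.2.1) * a p.2.2 * conj (a (fourth p)) +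
    a p.1 * conj (a p.2.1) * cubicSum a p.2.2 * conj (a (fourth p)) -
    a p.1 * conj (a p.2.1) * a p.2.2 * conj (cubicSum a (fourth p)))

/-- The time derivative of `|a_n|²` along the flow. -/
def massFlux (a : Z2 → ℂ) (n : Z2) : ℂ :=
  Complex.I * (cubicSum a n * conj (a n) - a n * conj (cubicSum a n))

lemma enorm_conj (z : ℂ) : ‖conj z‖ₑ = ‖z‖ₑ := by
  rw [← ofReal_norm, ← ofReal_norm, RCLike.norm_conj]

lemma enorm_cubicTerm (a : Z2 → ℂ) (p : Triple) :
    ‖cubicTerm a p‖ₑ = ‖a p.1‖ₑ * ‖a p.2.1‖ₑ * ‖a p.2.2‖ₑ := by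
  rw [cubicTerm, enorm_mul, enorm_mul, enorm_conj]

lemma enorm_cubicSum_le (a : Z2 → ℂ) (n : Z2) : ‖cubicSum a n‖ₑ ≤ conv3 (fun n => ‖a n‖ₑ) n := by
  refine enorm_tsum_le_tsum_enorm.trans (le_of_eq (tsum_congr fun p => ?_))
  rw [enorm_cubicTerm]

lemma enorm_quad (a : Z2 → ℂ) (p : Triple) : ‖quad a p‖ₑ = prod4 (fun n => ‖a n‖ₑ) p := by
  rw [quad, enorm_mul, enorm_mul, enorm_mul, enorm_conj, enorm_conj]; rfl

lemma enorm_four_le (z₁ z₂ z₃ z₄ : ℂ) :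
    ‖Complex.I * (z₁ - z₂ + z₃ - z₄)‖ₑ ≤ ‖z₁‖ₑ + ‖z₂‖ₑ + ‖z₃‖ₑ + ‖z₄‖ₑ := by
  rw [enorm_mul]
  have : ‖Complex.I‖ₑ = 1 := by rw [← ofReal_norm]; simp
  rw [this, one_mul]
  refine (enorm_sub_le).trans (add_le_add ?_ le_rfl)
  refine (enorm_add_le _ _).trans (add_le_add ?_ le_rfl)
  exact enorm_sub_le

lemma enorm_six_le (a : Z2 → ℂ) (p : Triple) : ‖six a p‖ₑ ≤ sixProd (fun n => ‖a n‖ₑ) p := by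
  refine (enorm_four_le _ _ _ _).trans ?_
  simp only [enorm_mul, enorm_conj, sixProd]
  gcongr <;> exact enorm_cubicSum_le a _

lemma enorm_massFlux_le (a : Z2 → ℂ) (n : Z2) :
    ‖massFlux a n‖ₑ ≤ 2 * (‖a n‖ₑ * conv3 (fun n => ‖a n‖ₑ) n) := by
  have h := enorm_four_le (cubicSum a n * conj (a n)) (a n * conj (cubicSum a n)) 0 0
  rw [add_zero, sub_zero] at h
  refine h.trans ?_
  simp only [enorm_mul, enorm_conj, enorm_zero, add_zero]
  have := enorm_cubicSum_le a n
  calc _ = 2 * (‖a n‖ₑ * ‖cubicSum a n‖ₑ) := by ring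
    _ ≤ _ := by gcongr

lemma tsum_fourth_fiber_complex {G : Z2 → Triple → ℂ} (hG : Summable fun p => G (fourth p) p) :
    ∑' n, ∑' p : {p : Triple // p.1 - p.2.1 + p.2.2 = n}, G n p.1 = ∑' p, G (fourth p) p := by
  have e : ∀ x, G (fourth (Equiv.sigmaFiberEquiv fourth x)) (Equiv.sigmaFiberEquiv fourth x) =
      G x.1 x.2.1 := by
    rintro ⟨n, p, rfl⟩
    rfl
  rw [← (Equiv.sigmaFiberEquiv fourth).tsum_eq fun p => G (fourth p) p]
  have hG' := (Equiv.sigmaFiberEquiv fourth).summable_iff.2 hG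
  refine Eq.trans ?_ (Summable.tsum_sigma hG').symm
  refine tsum_congr fun n => tsum_congr fun p => ?_
  exact (e ⟨n, p⟩).symm

lemma quad_swapPairs (a : Z2 → ℂ) (p : Triple) : quad a (swapPairs p) = conj (quad a p) := by
  rw [quad, quad, fourth_swapPairs, swapPairs_apply]
  simp only [map_mul, Complex.conj_conj]; ring

lemma quad_flipEven (a : Z2 → ℂ) (p : Triple) : quad a (flipEven p) = quad a p := by
  rw [quad, quad, fourth_flipEven, flipEven_apply]; ring

lemma quad_flipOdd (a : Z2 → ℂ) (p : Triple) : quad a (flipOdd p) = quad a p := by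
  rw [quad, quad, fourth_flipOdd, flipOdd_apply]; ring

/-- The derivative of the `H^r` norm, symmetrized over quadruples. -/
lemma tsum_massFlux_eq {r : ℝ} {a : Z2 → ℂ}
    (h : ∑' p, ENNReal.ofReal (weightSum r p) * prod4 (fun n => ‖a n‖ₑ) p ≠ ∞) :
    ∑' n, ((jb n ^ r : ℝ) : ℂ) * massFlux a n =
      -(Complex.I / 2) * ∑' p, ((weightAlt r p : ℝ) : ℂ) * quad a p := by
  have hs : ∀ x : Triple → Z2, (∀ p, jb (x p) ^ r ≤ weightSum r p) →
      Summable fun p => ((jb (x p) ^ r : ℝ) : ℂ) * quad a p := by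
    intro x hx
    refine Summable.of_enorm (ne_top_of_le_ne_top h (ENNReal.tsum_le_tsum fun p => ?_))
    rw [enorm_mul, enorm_quad, ← ofReal_norm, Complex.norm_real,
      Real.norm_of_nonneg (jb_rpow_nonneg _ _)]
    gcongr
    exact hx p
  have hj := jb_rpow_nonneg r
  have s1 := hs (fun p => p.1) fun p => by
    simp only [weightSum]; linarith [hj p.1, hj p.2.1, hj p.2.2, hj (fourth p)]
  have s2 := hs (fun p => p.2.1) fun p => by
    simp only [weightSum]; linarith [hj p.1, hj p.2.1, hj p.2.2, hj (fourth p)]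
  have s3 := hs (fun p => p.2.2) fun p => by
    simp only [weightSum]; linarith [hj p.1, hj p.2.1, hj p.2.2, hj (fourth p)]
  have s4 := hs fourth fun p => by
    simp only [weightSum]; linarith [hj p.1, hj p.2.1, hj p.2.2, hj (fourth p)]
  have e42 : ∑' p : Triple, ((jb p.2.1 ^ r : ℝ) : ℂ) * quad a p =
      ∑' p, ((jb (fourth p) ^ r : ℝ) : ℂ) * quad a p := by
    rw [← flipEven.tsum_eq]
    exact tsum_congr fun p => by rw [quad_flipEven, flipEven_apply]
  have e31 : ∑' p : Triple, ((jb p.1 ^ r : ℝ) : ℂ) * quad a p =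
      ∑' p : Triple, ((jb p.2.2 ^ r : ℝ) : ℂ) * quad a p := by
    rw [← flipOdd.tsum_eq]
    exact tsum_congr fun p => by rw [quad_flipOdd, flipOdd_apply]
  have f4 : ∑' n, ((jb n ^ r : ℝ) : ℂ) * (cubicSum a n * conj (a n)) =
      ∑' p, ((jb (fourth p) ^ r : ℝ) : ℂ) * quad a p := by
    refine Eq.trans (tsum_congr fun n => ?_) (tsum_fourth_fiber_complex
      (G := fun n p => ((jb n ^ r : ℝ) : ℂ) * (cubicTerm a p * conj (a n))) s4)
    rw [tsum_mul_left, tsum_mul_right]; rfl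
  have f3 : ∑' n, ((jb n ^ r : ℝ) : ℂ) * (a n * conj (cubicSum a n)) =
      ∑' p : Triple, ((jb p.2.2 ^ r : ℝ) : ℂ) * quad a p := by
    have c1 : ∑' n, ((jb n ^ r : ℝ) : ℂ) * (a n * conj (cubicSum a n)) =
        conj (∑' n, ((jb n ^ r : ℝ) : ℂ) * (cubicSum a n * conj (a n))) := by
      rw [Complex.conj_tsum]
      refine tsum_congr fun n => ?_
      simp only [map_mul, Complex.conj_conj, Complex.conj_ofReal]; ring
    rw [c1, f4, Complex.conj_tsum, ← swapPairs.tsum_eq]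
    refine tsum_congr fun p => ?_
    rw [quad_swapPairs, fourth_swapPairs]
    simp
  have hfl : ∀ n, ((jb n ^ r : ℝ) : ℂ) * massFlux a n =
      Complex.I * (((jb n ^ r : ℝ) : ℂ) * (cubicSum a n * conj (a n)) -
        ((jb n ^ r : ℝ) : ℂ) * (a n * conj (cubicSum a n))) := fun n => by
    rw [massFlux]; ring
  have hN : Summable fun n => ((jb n ^ r : ℝ) : ℂ) * (cubicSum a n * conj (a n)) := by
    have := ((Equiv.sigmaFiberEquiv fourth).summable_iff.2 s4).sigma
    refine this.congr fun n => ?_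
    rw [cubicSum, ← tsum_mul_right, ← tsum_mul_left]
    refine tsum_congr fun p => ?_
    obtain ⟨p, rfl⟩ := p
    rfl
  have hN' : Summable fun n => ((jb n ^ r : ℝ) : ℂ) * (a n * conj (cubicSum a n)) := by
    refine (Complex.summable_conj.2 hN).congr fun n => ?_
    simp only [map_mul, Complex.conj_conj, Complex.conj_ofReal]; ring
  simp only [hfl]
  rw [tsum_mul_left, hN.tsum_sub hN', f4, f3]
  have hw : ∀ p, ((weightAlt r p : ℝ) : ℂ) * quad a p =
      ((jb p.1 ^ r : ℝ) : ℂ) * quad a p - ((jb p.2.1 ^ r : ℝ) : ℂ) * quad a p +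
      ((jb p.2.2 ^ r : ℝ) : ℂ) * quad a p - ((jb (fourth p) ^ r : ℝ) : ℂ) * quad a p := by
    intro p
    rw [weightAlt]; push_cast; ring
  simp only [hw]
  rw [((s1.sub s2).add s3).tsum_sub s4, (s1.sub s2).tsum_add s3, s1.tsum_sub s2, e42, e31]
  ring

lemma tsum_six_eq_zero {a : Z2 → ℂ} (h : ∑' p, sixProd (fun n => ‖a n‖ₑ) p ≠ ∞) :
    ∑' p, six a p = 0 := by
  set N := cubicSum a
  have hN := enorm_cubicSum_le a
  have hs : ∀ f : Triple → ℂ, (∀ p, ‖f p‖ₑ ≤ sixProd (fun n => ‖a n‖ₑ) p) → Summable f :=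
    fun f hf => Summable.of_enorm (ne_top_of_le_ne_top h (ENNReal.tsum_le_tsum hf))
  have s1 : Summable fun p : Triple => N p.1 * conj (a p.2.1) * a p.2.2 * conj (a (fourth p)) := by
    refine hs _ fun p => ?_
    simp only [enorm_mul, enorm_conj, sixProd]
    exact (mul_le_mul' (mul_le_mul' (mul_le_mul' (hN _) le_rfl) le_rfl) le_rfl).trans
      (le_self_add.trans (le_self_add.trans le_self_add))
  have s2 : Summable fun p : Triple => a p.1 * conj (N p.2.1) * a p.2.2 * conj (a (fourth p)) := by
    refine hs _ fun p => ?_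
    simp only [enorm_mul, enorm_conj, sixProd]
    exact (mul_le_mul' (mul_le_mul' (mul_le_mul' le_rfl (hN _)) le_rfl) le_rfl).trans
      (le_add_self.trans (le_self_add.trans le_self_add))
  have s3 : Summable fun p : Triple => a p.1 * conj (a p.2.1) * N p.2.2 * conj (a (fourth p)) := by
    refine hs _ fun p => ?_
    simp only [enorm_mul, enorm_conj, sixProd]
    exact (mul_le_mul' (mul_le_mul' le_rfl (hN _)) le_rfl).trans (le_add_self.trans le_self_add)
  have s4 : Summable fun p : Triple => a p.1 * conj (a p.2.1) * a p.2.2 * conj (N (fourth p)) := by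
    refine hs _ fun p => ?_
    simp only [enorm_mul, enorm_conj, sixProd]
    exact (mul_le_mul' le_rfl (hN _)).trans le_add_self
  have e4 : conj (∑' p : Triple, a p.1 * conj (a p.2.1) * a p.2.2 * conj (N (fourth p))) =
      ∑' p : Triple, a p.1 * conj (a p.2.1) * a p.2.2 * conj (N (fourth p)) := by
    have := tsum_fourth_fiber_complex (G := fun n p => cubicTerm a p * conj (N n)) s4
    change _ = ∑' p : Triple, a p.1 * conj (a p.2.1) * a p.2.2 * conj (N (fourth p)) at this
    rw [← this, Complex.conj_tsum]
    refine tsum_congr fun n => ?_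
    rw [tsum_mul_right]
    change conj (N n * conj (N n)) = N n * conj (N n)
    rw [map_mul, Complex.conj_conj, mul_comm]
  have e3 : ∑' p : Triple, a p.1 * conj (a p.2.1) * N p.2.2 * conj (a (fourth p)) =
      ∑' p : Triple, a p.1 * conj (a p.2.1) * a p.2.2 * conj (N (fourth p)) := by
    rw [← e4, Complex.conj_tsum, ← swapPairs.tsum_eq]
    refine tsum_congr fun p => ?_
    rw [fourth_swapPairs, swapPairs_apply]
    simp only [map_mul, Complex.conj_conj]; ring
  have e1 : ∑' p : Triple, N p.1 * conj (a p.2.1) * a p.2.2 * conj (a (fourth p)) =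
      ∑' p : Triple, a p.1 * conj (a p.2.1) * N p.2.2 * conj (a (fourth p)) := by
    rw [← flipOdd.tsum_eq]
    refine tsum_congr fun p => ?_
    rw [fourth_flipOdd, flipOdd_apply]; ring
  have e2 : ∑' p : Triple, a p.1 * conj (N p.2.1) * a p.2.2 * conj (a (fourth p)) =
      ∑' p : Triple, a p.1 * conj (a p.2.1) * a p.2.2 * conj (N (fourth p)) := by
    rw [← flipEven.tsum_eq]
    refine tsum_congr fun p => ?_
    rw [fourth_flipEven, flipEven_apply]; ring
  simp only [six]
  rw [tsum_mul_left, ((s1.sub s2).add s3).tsum_sub s4, (s1.sub s2).tsum_add s3, s1.tsum_sub s2,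
    e1, e2, e3]
  ring

/-- The parametrization of quadruples by the common value `m = n₁ + n₃ = n₂ + n₄`. -/
def diagonalEquiv : Z2 × Z2 × Z2 ≃ Triple where
  toFun x := (x.2.1, x.2.2, x.1 - x.2.1)
  invFun p := (p.1 + p.2.2, p.1, p.2.1)
  left_inv x := by simp
  right_inv p := by simp

lemma re_tsum_quad_nonneg {a : Z2 → ℂ} (ha : Summable fun n => ‖a n‖) (hq : Summable (quad a)) :
    0 ≤ (∑' p, quad a p).re := by
  let b : Z2 → Z2 → ℂ := fun m n => a n * a (m - n)
  have hb : ∀ m, Summable (b m) := fun m =>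
    (summable_mul_of_summable_norm ha ha).comp_injective (i := fun n => (n, m - n))
      fun x y hxy => (Prod.mk.inj hxy).1
  have e : ∀ x, quad a (diagonalEquiv x) = b x.1 x.2.1 * conj (b x.1 x.2.2) := by
    intro x
    have : fourth (diagonalEquiv x) = x.1 - x.2.2 := by
      simp only [fourth, diagonalEquiv, Equiv.coe_fn_mk]; abel
    rw [quad, this]
    simp only [diagonalEquiv, Equiv.coe_fn_mk, b, map_mul]; ring
  have hq' : Summable fun x : Z2 × Z2 × Z2 => b x.1 x.2.1 * conj (b x.1 x.2.2) :=
    (diagonalEquiv.summable_iff.2 hq).congr fun x => e x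
  have key : ∑' p, quad a p = ((∑' m, ‖∑' n, b m n‖ ^ 2 : ℝ) : ℂ) := by
    rw [← diagonalEquiv.tsum_eq, tsum_congr e, hq'.tsum_prod, Complex.ofReal_tsum]
    refine tsum_congr fun m => ?_
    rw [(hq'.prod_factor m).tsum_prod]
    simp only [tsum_mul_left, tsum_mul_right]
    rw [← Complex.conj_tsum, Complex.mul_conj, Complex.normSq_eq_norm_sq]
  rw [key, Complex.ofReal_re]
  exact tsum_nonneg fun m => by positivity

/-! ### Time derivatives -/

lemma IsSolutionV.hasDerivAt {a : ℝ → Z2 → ℂ} (ha : IsSolutionV (fun _ => 0) a) (n : Z2) (t : ℝ) :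
    HasDerivAt (fun τ => a τ n)
      (Complex.I * ((nsq n : ℂ) * a t n + cubicSum (a t) n)) t := by
  obtain ⟨-, d, hd, h⟩ := ha n t
  rw [add_zero] at h
  change _ = _ + cubicSum (a t) n at h
  rw [← h]
  convert hd using 1
  rw [← mul_assoc, mul_neg, Complex.I_mul_I, neg_neg, one_mul]

lemma IsSolutionV.hasDerivAt_conj {a : ℝ → Z2 → ℂ} (ha : IsSolutionV (fun _ => 0) a) (n : Z2)
    (t : ℝ) : HasDerivAt (fun τ => conj (a τ n))
      (-Complex.I * ((nsq n : ℂ) * conj (a t n) + conj (cubicSum (a t) n))) t := by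
  have h := (ha.hasDerivAt n t).star
  convert! h using 1
  rw [← starRingEnd_apply]
  simp only [map_mul, map_add, Complex.conj_I, Complex.conj_ofReal]

lemma IsSolutionV.hasDerivAt_normSq {a : ℝ → Z2 → ℂ} (ha : IsSolutionV (fun _ => 0) a) (n : Z2)
    (t : ℝ) : HasDerivAt (fun τ => ((‖a τ n‖ ^ 2 : ℝ) : ℂ)) (massFlux (a t) n) t := by
  have h := (ha.hasDerivAt n t).mul (ha.hasDerivAt_conj n t)
  convert! h using 1
  · funext τ
    rw [Pi.mul_apply, Complex.mul_conj, Complex.normSq_eq_norm_sq]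
  · rw [massFlux]; ring

lemma IsSolutionV.hasDerivAt_quad {a : ℝ → Z2 → ℂ} (ha : IsSolutionV (fun _ => 0) a) (p : Triple)
    (t : ℝ) : HasDerivAt (fun τ => quad (a τ) p)
      (Complex.I * (resonance p : ℂ) * quad (a t) p + six (a t) p) t := by
  have h := (((ha.hasDerivAt p.1 t).mul (ha.hasDerivAt_conj p.2.1 t)).mul
    (ha.hasDerivAt p.2.2 t)).mul (ha.hasDerivAt_conj (fourth p) t)
  convert! h using 1
  simp only [Pi.mul_apply, quad, six, resonance]
  push_cast
  ring

lemma weightSum_mono {r s : ℝ} (h : r ≤ s) (p : Triple) : weightSum r p ≤ weightSum s p := by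
  have := fun n => Real.rpow_le_rpow_of_exponent_le (one_le_jb n) h
  unfold weightSum
  linarith [this p.1, this p.2.1, this p.2.2, this (fourth p)]

lemma abs_weightAlt_le_weightSum (r : ℝ) (p : Triple) : |weightAlt r p| ≤ weightSum r p := by
  have h := jb_rpow_nonneg r
  unfold weightSum weightAlt
  rw [abs_le]
  constructor <;> linarith [h p.1, h p.2.1, h p.2.2, h (fourth p)]

lemma weightAlt_one (p : Triple) : weightAlt 1 p = resonance p := by
  simp only [weightAlt, resonance, Real.rpow_one, jb]; ring

lemma one_le_weightSum {s : ℝ} (hs : 0 ≤ s) (p : Triple) : 1 ≤ weightSum s p := by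
  have h := jb_rpow_nonneg s
  unfold weightSum
  linarith [h p.2.1, h p.2.2, h (fourth p), Real.one_le_rpow (one_le_jb p.1) hs]

lemma tsum_jb_massFlux_le {r s : ℝ} (hr : r ≤ s) (a : Z2 → ℂ) :
    ∑' n, ‖((jb n ^ r : ℝ) : ℂ) * massFlux a n‖ₑ ≤
      2 * ∑' p, ENNReal.ofReal (weightSum s p) * prod4 (fun n => ‖a n‖ₑ) p := by
  set c : Z2 → ℝ≥0∞ := fun n => ‖a n‖ₑ
  calc _ ≤ ∑' n, 2 * (ENNReal.ofReal (jb n ^ r) * (c n * conv3 c n)) := by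
        refine ENNReal.tsum_le_tsum fun n => ?_
        rw [enorm_mul, ← ofReal_norm, Complex.norm_real, Real.norm_of_nonneg (jb_rpow_nonneg _ _),
          mul_left_comm]
        exact mul_le_mul' le_rfl (enorm_massFlux_le a n)
    _ = 2 * ∑' p, ENNReal.ofReal (jb (fourth p) ^ r) * prod4 c p := by
        rw [ENNReal.tsum_mul_left]
        congr 1
        refine Eq.trans (tsum_congr fun n => ?_) (tsum_fourth_fiber (fun n p =>
          ENNReal.ofReal (jb n ^ r) * (c p.1 * c p.2.1 * c p.2.2 * c n)))
        rw [conv3, ENNReal.tsum_mul_left, ENNReal.tsum_mul_right, mul_comm (c n)]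
    _ ≤ _ := by
        gcongr with p
        refine le_trans ?_ (weightSum_mono hr p)
        have h := jb_rpow_nonneg r
        simp only [weightSum]
        linarith [h p.1, h p.2.1, h p.2.2]

lemma summable_of_sobolevE {r : ℝ} {a : Z2 → ℂ} (h : sobolevE r (fun n => ‖a n‖ₑ) ≠ ∞) :
    Summable fun n => ((jb n ^ r : ℝ) : ℂ) * ((‖a n‖ ^ 2 : ℝ) : ℂ) := by
  refine Summable.of_enorm (ne_top_of_le_ne_top h (ENNReal.tsum_le_tsum fun n => le_of_eq ?_))
  rw [enorm_mul, ← ofReal_norm, ← ofReal_norm, Complex.norm_real, Complex.norm_real,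
    Real.norm_of_nonneg (jb_rpow_nonneg _ _), Real.norm_of_nonneg (by positivity),
    ENNReal.ofReal_pow (norm_nonneg _), ofReal_norm]

/-- The `H^r` energy corrected by the quartic form with multiplier `μ / 2`. -/
def modifiedEnergy (r : ℝ) (μ : Triple → ℝ) (a : Z2 → ℂ) : ℂ :=
  ∑' n, ((jb n ^ r : ℝ) : ℂ) * ((‖a n‖ ^ 2 : ℝ) : ℂ) + ∑' p, ((μ p / 2 : ℝ) : ℂ) * quad a p

/-- Almost conservation of a modified energy. -/
lemma norm_modifiedEnergy_sub_le {r s : ℝ} (hs : 1 < s) (hr : r ≤ s) {a : ℝ → Z2 → ℂ}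
    (ha : IsSolutionV (fun _ => 0) a) {μ : Triple → ℝ} (h1 : ∀ p, |μ p| ≤ weightSum s p)
    (h2 : ∀ p, |μ p * resonance p| ≤ weightSum s p) {x y D : ℝ} (hxy : x ≤ y) {S : ℝ≥0}
    (hS : ∀ t ∈ Icc x y, sobolevE s (fun n => ‖a t n‖ₑ) ≤ S)
    (hD : ∀ t ∈ Icc x y, ‖∑' p, (Complex.I * ((μ p * resonance p - weightAlt r p : ℝ) : ℂ) *
      quad (a t) p + (μ p : ℂ) * six (a t) p)‖ ≤ 2 * D) :
    ‖modifiedEnergy r μ (a y) - modifiedEnergy r μ (a x)‖ ≤ D * (y - x) := by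
  obtain ⟨C, hC⟩ := exists_tsum_weightSum_prod_le hs
  set M : ℝ≥0 := C * (S ^ 2 + S ^ 3)
  have hW : ∀ t ∈ Icc x y, ∑' p, ENNReal.ofReal (weightSum s p) *
      (prod4 (fun n => ‖a t n‖ₑ) p + sixProd (fun n => ‖a t n‖ₑ) p) ≤ M :=
    fun t ht => hC _ S (hS t ht)
  have hW4 : ∀ t ∈ Icc x y, ∑' p, ENNReal.ofReal (weightSum s p) *
      prod4 (fun n => ‖a t n‖ₑ) p ≤ M := fun t ht =>
    (ENNReal.tsum_le_tsum fun p => mul_le_mul' le_rfl le_self_add).trans (hW t ht)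
  have hW6 : ∀ t ∈ Icc x y, ∑' p, ENNReal.ofReal (weightSum s p) *
      sixProd (fun n => ‖a t n‖ₑ) p ≤ M := fun t ht =>
    (ENNReal.tsum_le_tsum fun p => mul_le_mul' le_rfl le_add_self).trans (hW t ht)
  have e4 : ∀ (k : Triple → ℝ), (∀ p, |k p| ≤ weightSum s p) → ∀ t ∈ Icc x y,
      ∑' p, ‖(k p : ℂ) * quad (a t) p‖ₑ ≤ M := by
    intro k hk t ht
    refine (ENNReal.tsum_le_tsum fun p => ?_).trans (hW4 t ht)
    rw [enorm_mul, enorm_quad, ← ofReal_norm, Complex.norm_real, Real.norm_eq_abs]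
    gcongr
    exact hk p
  have e6 : ∀ (k : Triple → ℝ), (∀ p, |k p| ≤ weightSum s p) → ∀ t ∈ Icc x y,
      ∑' p, ‖(k p : ℂ) * six (a t) p‖ₑ ≤ M := by
    intro k hk t ht
    refine (ENNReal.tsum_le_tsum fun p => ?_).trans (hW6 t ht)
    rw [enorm_mul, ← ofReal_norm, Complex.norm_real, Real.norm_eq_abs]
    exact mul_le_mul' (ENNReal.ofReal_le_ofReal (hk p)) (enorm_six_le _ p)
  have hfin : ∀ {z : ℝ≥0∞}, z ≤ M → z ≠ ∞ := fun h => ne_top_of_le_ne_top ENNReal.coe_ne_top h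
  have h1' : ∀ p, |μ p / 2| ≤ weightSum s p := fun p => by
    rw [abs_div, abs_two]; linarith [h1 p, abs_nonneg (μ p)]
  have h2' : ∀ p, |μ p * resonance p / 2| ≤ weightSum s p := fun p => by
    rw [abs_div, abs_two]; linarith [h2 p, abs_nonneg (μ p * resonance p)]
  have h3' : ∀ p, |weightAlt r p| ≤ weightSum s p := fun p =>
    (abs_weightAlt_le_weightSum r p).trans (weightSum_mono hr p)
  have nI : ‖Complex.I‖ₑ = 1 := by rw [← ofReal_norm]; simp
  refine norm_tsum_add_tsum_sub_le
    (f := fun n t => ((jb n ^ r : ℝ) : ℂ) * ((‖a t n‖ ^ 2 : ℝ) : ℂ))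
    (f' := fun n t => ((jb n ^ r : ℝ) : ℂ) * massFlux (a t) n)
    (g := fun p t => ((μ p / 2 : ℝ) : ℂ) * quad (a t) p)
    (g' := fun p t => ((μ p / 2 : ℝ) : ℂ) *
      (Complex.I * (resonance p : ℂ) * quad (a t) p + six (a t) p))
    (A := 2 * M) (B := M + M)
    (fun n t => (ha.hasDerivAt_normSq n t).const_mul _)
    (fun p t => (ha.hasDerivAt_quad p t).const_mul _) hxy ?_ ?_ ?_ ?_ ?_
  · intro t ht
    refine (tsum_jb_massFlux_le hr (a t)).trans ?_
    rw [ENNReal.coe_mul]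
    exact mul_le_mul' le_rfl (hW4 t ht)
  · intro t ht
    rw [ENNReal.coe_add]
    refine le_trans ?_ (add_le_add (e4 _ h2' t ht) (e6 _ h1' t ht))
    rw [← ENNReal.tsum_add]
    refine ENNReal.tsum_le_tsum fun p => ?_
    have : ((μ p / 2 : ℝ) : ℂ) * (Complex.I * (resonance p : ℂ) * quad (a t) p + six (a t) p) =
        Complex.I * (((μ p * resonance p / 2 : ℝ) : ℂ) * quad (a t) p) +
          ((μ p / 2 : ℝ) : ℂ) * six (a t) p := by push_cast; ring
    rw [this]
    refine (enorm_add_le _ _).trans (add_le_add (le_of_eq ?_) le_rfl)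
    rw [enorm_mul, nI, one_mul]
  · intro t ht
    exact summable_of_sobolevE (ne_top_of_le_ne_top ENNReal.coe_ne_top
      ((sobolevE_mono hr _).trans (hS t ht)))
  · intro t ht
    exact Summable.of_enorm (hfin (e4 _ h1' t ht))
  · intro t ht
    have q1 := Summable.of_enorm (hfin (e4 _ h3' t ht))
    have q2 := Summable.of_enorm (hfin (e4 _ h2 t ht))
    have q3 := Summable.of_enorm (hfin (e6 _ h1 t ht))
    rw [tsum_massFlux_eq (ne_top_of_le_ne_top (hfin (hW4 t ht)) (ENNReal.tsum_le_tsum fun p =>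
      mul_le_mul' (ENNReal.ofReal_le_ofReal (weightSum_mono hr p)) le_rfl))]
    have e1 : ∀ p, ((μ p / 2 : ℝ) : ℂ) *
        (Complex.I * (resonance p : ℂ) * quad (a t) p + six (a t) p) =
        (1 / 2 : ℂ) * (Complex.I * (((μ p * resonance p : ℝ) : ℂ) * quad (a t) p) +
          (μ p : ℂ) * six (a t) p) := fun p => by push_cast; ring
    have e2 : ∀ p, Complex.I * ((μ p * resonance p - weightAlt r p : ℝ) : ℂ) *
        quad (a t) p + (μ p : ℂ) * six (a t) p =
        Complex.I * (((μ p * resonance p : ℝ) : ℂ) * quad (a t) p) -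
        Complex.I * (((weightAlt r p : ℝ) : ℂ) * quad (a t) p) +
        (μ p : ℂ) * six (a t) p := fun p => by push_cast; ring
    have hd := hD t ht
    rw [tsum_congr e2, ((q2.mul_left _).sub (q1.mul_left _)).tsum_add q3,
      (q2.mul_left _).tsum_sub (q1.mul_left _), tsum_mul_left, tsum_mul_left] at hd
    rw [tsum_congr e1, tsum_mul_left, (q2.mul_left _).tsum_add q3, tsum_mul_left]
    set X := ∑' p, ((μ p * resonance p : ℝ) : ℂ) * quad (a t) p
    set Y := ∑' p, ((weightAlt r p : ℝ) : ℂ) * quad (a t) p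
    set Z := ∑' p, (μ p : ℂ) * six (a t) p
    have : -(Complex.I / 2) * Y + 1 / 2 * (Complex.I * X + Z) =
        (1 / 2 : ℂ) * (Complex.I * X - Complex.I * Y + Z) := by ring
    rw [this, norm_mul]
    norm_num
    linarith

/-! ### Sobolev norms of solutions -/

lemma HsNormSq_nonneg (r : ℝ) (a : Z2 → ℂ) : 0 ≤ HsNormSq r a :=
  tsum_nonneg fun n => mul_nonneg (jb_rpow_nonneg r n) (by positivity)

lemma sobolevE_enorm {r : ℝ} {a : Z2 → ℂ} (h : HsFinite r a) :
    sobolevE r (fun n => ‖a n‖ₑ) = ENNReal.ofReal (HsNormSq r a) := by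
  refine Eq.trans (tsum_congr fun n => ?_) (ENNReal.ofReal_tsum_of_nonneg
    (fun n => mul_nonneg (jb_rpow_nonneg r n) (by positivity)) h).symm
  rw [ENNReal.ofReal_mul (jb_rpow_nonneg r n), ENNReal.ofReal_pow (norm_nonneg _), ofReal_norm]

lemma HsFinite.mono {r s : ℝ} (hrs : r ≤ s) {a : Z2 → ℂ} (h : HsFinite s a) : HsFinite r a :=
  Summable.of_nonneg_of_le (fun n => mul_nonneg (jb_rpow_nonneg r n) (by positivity))
    (fun n => mul_le_mul_of_nonneg_right
      (Real.rpow_le_rpow_of_exponent_le (one_le_jb n) hrs) (by positivity)) h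

lemma HsFinite.HsNormSq_mono {r s : ℝ} (hrs : r ≤ s) {a : Z2 → ℂ} (h : HsFinite s a) :
    HsNormSq r a ≤ HsNormSq s a :=
  (h.mono hrs).tsum_le_tsum (fun n => mul_le_mul_of_nonneg_right
      (Real.rpow_le_rpow_of_exponent_le (one_le_jb n) hrs) (by positivity)) h

lemma modifiedEnergy_eq (r : ℝ) (μ : Triple → ℝ) (a : Z2 → ℂ) :
    modifiedEnergy r μ a = (HsNormSq r a : ℂ) + ∑' p, ((μ p / 2 : ℝ) : ℂ) * quad a p := by
  rw [modifiedEnergy, HsNormSq, Complex.ofReal_tsum]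
  congr 1
  exact tsum_congr fun n => by push_cast [jb]; rfl

lemma norm_tsum_le_of_tsum_enorm_le {ι : Type*} {f : ι → ℂ} {M : ℝ} (hM : 0 ≤ M)
    (h : ∑' i, ‖f i‖ₑ ≤ ENNReal.ofReal M) : ‖∑' i, f i‖ ≤ M := by
  have hf : Summable f := Summable.of_enorm (ne_top_of_le_ne_top ENNReal.ofReal_ne_top h)
  rw [← ENNReal.ofReal_le_ofReal_iff hM, ofReal_norm]
  exact (enorm_tsum_le_tsum_enorm).trans h

/-- Almost conservation of a modified energy, in either time direction. -/
lemma norm_modifiedEnergy_sub_le_abs {r s : ℝ} (hs : 1 < s) (hr : r ≤ s) {a : ℝ → Z2 → ℂ}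
    (ha : IsSolutionV (fun _ => 0) a) (hfin : ∀ t, HsFinite s (a t)) {μ : Triple → ℝ}
    (h1 : ∀ p, |μ p| ≤ weightSum s p) (h2 : ∀ p, |μ p * resonance p| ≤ weightSum s p) {x y D : ℝ}
    (hb : BddAbove ((fun t => HsNormSq s (a t)) '' uIcc x y))
    (hD : ∀ t ∈ uIcc x y, ‖∑' p, (Complex.I * ((μ p * resonance p - weightAlt r p : ℝ) : ℂ) *
      quad (a t) p + (μ p : ℂ) * six (a t) p)‖ ≤ 2 * D) :
    ‖modifiedEnergy r μ (a y) - modifiedEnergy r μ (a x)‖ ≤ D * |y - x| := by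
  obtain ⟨S, hS⟩ := hb
  have hbd : ∀ t ∈ uIcc x y, sobolevE s (fun n => ‖a t n‖ₑ) ≤ (S.toNNReal : ℝ≥0) := by
    intro t ht
    rw [sobolevE_enorm (hfin t)]
    exact ENNReal.ofReal_le_ofReal (hS (mem_image_of_mem _ ht))
  rcases le_total x y with h | h
  · rw [uIcc_of_le h] at hD hbd
    rw [abs_of_nonneg (sub_nonneg.2 h)]
    exact norm_modifiedEnergy_sub_le hs hr ha h1 h2 h hbd hD
  · rw [uIcc_of_ge h] at hD hbd
    rw [norm_sub_rev, abs_sub_comm, abs_of_nonneg (sub_nonneg.2 h)]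
    exact norm_modifiedEnergy_sub_le hs hr ha h1 h2 h hbd hD

/-- The conserved Hamiltonian controls the `H¹` norm. -/
lemma exists_HsNormSq_one_le {s : ℝ} (hs : 1 < s) : ∃ C : ℝ, 0 ≤ C ∧ ∀ a : ℝ → Z2 → ℂ,
    IsSolutionV (fun _ => 0) a → (∀ t, HsFinite s (a t)) → ∀ x y : ℝ,
    BddAbove ((fun t => HsNormSq s (a t)) '' uIcc x y) →
    HsNormSq 1 (a y) ≤ HsNormSq s (a x) + C * (HsNormSq s (a x) ^ 2 + HsNormSq s (a x) ^ 3) := by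
  obtain ⟨C, hC⟩ := exists_tsum_weightSum_prod_le hs
  refine ⟨C, C.2, fun a ha hfin x y hb => ?_⟩
  have hW : ∀ t, ∑' p, ENNReal.ofReal (weightSum s p) *
      (prod4 (fun n => ‖a t n‖ₑ) p + sixProd (fun n => ‖a t n‖ₑ) p) ≤
      ENNReal.ofReal (C * (HsNormSq s (a t) ^ 2 + HsNormSq s (a t) ^ 3)) := by
    intro t
    refine (hC _ (HsNormSq s (a t)).toNNReal (sobolevE_enorm (hfin t)).le).trans (le_of_eq ?_)
    rw [← ENNReal.ofReal_coe_nnreal]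
    push_cast
    rw [Real.coe_toNNReal _ (HsNormSq_nonneg _ _)]
  have hone : ∀ p, 1 ≤ ENNReal.ofReal (weightSum s p) := fun p => by
    rw [ENNReal.one_le_ofReal]; exact one_le_weightSum (by linarith) p
  have h4 : ∀ t, ∑' p, ‖quad (a t) p‖ₑ ≤
      ENNReal.ofReal (C * (HsNormSq s (a t) ^ 2 + HsNormSq s (a t) ^ 3)) := fun t => by
    refine (ENNReal.tsum_le_tsum fun p => ?_).trans (hW t)
    rw [enorm_quad]
    exact le_self_add.trans (le_mul_of_one_le_left' (hone p))
  have h6 : ∀ t, ∑' p, sixProd (fun n => ‖a t n‖ₑ) p ≠ ∞ := fun t => by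
    refine ne_top_of_le_ne_top ENNReal.ofReal_ne_top
      ((ENNReal.tsum_le_tsum fun p => ?_).trans (hW t))
    exact le_add_self.trans (le_mul_of_one_le_left' (hone p))
  have hsub := norm_modifiedEnergy_sub_le_abs (μ := fun _ => 1) (D := 0) hs hs.le ha hfin
    (fun p => by simpa using one_le_weightSum (by linarith) p)
    (fun p => by
      rw [one_mul, ← weightAlt_one]
      exact (abs_weightAlt_le_weightSum 1 p).trans (weightSum_mono hs.le p)) hb
    (fun t _ => by
      have : ∀ p, Complex.I * ((1 * resonance p - weightAlt 1 p : ℝ) : ℂ) * quad (a t) p +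
          ((1 : ℝ) : ℂ) * six (a t) p = six (a t) p := fun p => by
        rw [weightAlt_one]; simp
      rw [tsum_congr this, tsum_six_eq_zero (h6 t)]; simp)
  rw [zero_mul, modifiedEnergy_eq, modifiedEnergy_eq, tsum_mul_left, tsum_mul_left] at hsub
  have hre := congrArg Complex.re (sub_eq_zero.1 (norm_le_zero_iff.1 hsub))
  rw [Complex.add_re, Complex.add_re, Complex.ofReal_re, Complex.ofReal_re, Complex.re_ofReal_mul,
    Complex.re_ofReal_mul] at hre
  have hpos : 0 ≤ (∑' p, quad (a y) p).re := by
    refine re_tsum_quad_nonneg (Summable.of_enorm ?_)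
      (Summable.of_enorm (ne_top_of_le_ne_top ENNReal.ofReal_ne_top (h4 y)))
    have := tsum_ne_top_of_sobolevE (ε := s - 1) (c := fun n => ‖a y n‖ₑ) (by linarith) (by
      rw [add_sub_cancel, sobolevE_enorm (hfin y)]; exact ENNReal.ofReal_ne_top)
    simpa using this
  have hN := HsNormSq_nonneg s (a x)
  have hM : 0 ≤ C * (HsNormSq s (a x) ^ 2 + HsNormSq s (a x) ^ 3) := by positivity
  have hq := norm_tsum_le_of_tsum_enorm_le hM (h4 x)
  have := (Complex.re_le_norm (∑' p, quad (a x) p)).trans hq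
  have := (hfin x).HsNormSq_mono hs.le
  linarith

lemma one_le_abs_resonance {p : Triple} (h : resonance p ≠ 0) : 1 ≤ |resonance p| := by
  have : ∃ k : ℤ, resonance p = k := ⟨p.1.1 ^ 2 + p.1.2 ^ 2 - (p.2.1.1 ^ 2 + p.2.1.2 ^ 2) +
    (p.2.2.1 ^ 2 + p.2.2.2 ^ 2) - ((fourth p).1 ^ 2 + (fourth p).2 ^ 2), by
      simp only [resonance, nsq]; push_cast; ring⟩
  obtain ⟨k, hk⟩ := this
  rw [hk] at h ⊢
  exact_mod_cast Int.one_le_abs (by exact_mod_cast h)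

/-- The multiplier `ψ / ω` of the correction term; it vanishes on resonant quadruples. -/
def correction (s : ℝ) (p : Triple) : ℝ := weightAlt s p / resonance p

lemma abs_correction_le (s : ℝ) (p : Triple) :
    |correction s p| ≤ 2 * (|weightAlt s p| / (1 + |resonance p|)) := by
  rw [correction, abs_div]
  by_cases h : resonance p = 0
  · simp only [h, abs_zero, div_zero]; positivity
  · have := one_le_abs_resonance h
    rw [← mul_div_assoc, div_le_div_iff₀ (by positivity) (by positivity)]
    nlinarith [abs_nonneg (weightAlt s p)]

lemma abs_correction_le_weightSum (s : ℝ) (p : Triple) : |correction s p| ≤ weightSum s p := by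
  refine le_trans ?_ (abs_weightAlt_le_weightSum s p)
  rw [correction, abs_div]
  by_cases h : resonance p = 0
  · simp [h]
  · exact div_le_self (abs_nonneg _) (one_le_abs_resonance h)

lemma abs_correction_mul_resonance_le (s : ℝ) (p : Triple) :
    |correction s p * resonance p| ≤ weightSum s p := by
  refine le_trans ?_ (abs_weightAlt_le_weightSum s p)
  by_cases h : resonance p = 0
  · simp [h]
  · rw [correction, div_mul_cancel₀ _ h]

lemma abs_correction_mul_resonance_sub_le (s : ℝ) (p : Triple) :
    |correction s p * resonance p - weightAlt s p| ≤ |weightAlt s p| / (1 + |resonance p|) := by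
  by_cases h : resonance p = 0
  · simp [h]
  · rw [correction, div_mul_cancel₀ _ h, sub_self, abs_zero]; positivity

/-- Growth of the `H^s` norm in terms of a bound on the `H^1` norm and of an a priori bound. -/
lemma exists_HsNormSq_le_of_le {s : ℝ} (hs : 1 < s) : ∃ γ C : ℝ, 0 < γ ∧ γ ≤ 1 ∧ 0 ≤ C ∧
    ∀ a : ℝ → Z2 → ℂ, IsSolutionV (fun _ => 0) a → (∀ t, HsFinite s (a t)) → ∀ x y K S : ℝ,
    1 ≤ K → 1 ≤ S → (∀ t ∈ uIcc x y, HsNormSq 1 (a t) ≤ K ∧ HsNormSq s (a t) ≤ S) →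
    HsNormSq s (a y) ≤ HsNormSq s (a x) + C * K ^ 3 * (2 + |y - x|) * S ^ (1 - γ) := by
  obtain ⟨γ, C, hγ, hγ1, hC, h⟩ := exists_modified_energy_le hs
  refine ⟨γ, C, hγ, hγ1, hC, fun a ha hfin x y K S hK hS hb => ?_⟩
  set M := C * K ^ 3 * S ^ (1 - γ)
  have hM : 0 ≤ M := by positivity
  have key : ∀ t ∈ uIcc x y, ∑' p, ENNReal.ofReal (|weightAlt s p| / (1 + |resonance p|)) *
      (prod4 (fun n => ‖a t n‖ₑ) p + sixProd (fun n => ‖a t n‖ₑ) p) ≤ ENNReal.ofReal M := by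
    intro t ht
    refine h _ K S hK hS ?_ ?_
    · rw [sobolevE_enorm ((hfin t).mono hs.le)]
      exact ENNReal.ofReal_le_ofReal (hb t ht).1
    · rw [sobolevE_enorm (hfin t)]
      exact ENNReal.ofReal_le_ofReal (hb t ht).2
  have henorm : ∀ k : ℝ, ‖(k : ℂ)‖ₑ = ENNReal.ofReal |k| := fun k => by
    rw [← ofReal_norm, Complex.norm_real, Real.norm_eq_abs]
  have nI : ‖Complex.I‖ₑ = 1 := by rw [← ofReal_norm]; simp
  have htwo : ∀ w : ℝ, ENNReal.ofReal (2 * w) = 2 * ENNReal.ofReal w := fun w => by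
    rw [ENNReal.ofReal_mul (by norm_num), ENNReal.ofReal_ofNat]
  have hD : ∀ t ∈ uIcc x y, ‖∑' p, (Complex.I *
      ((correction s p * resonance p - weightAlt s p : ℝ) : ℂ) *
      quad (a t) p + (correction s p : ℂ) * six (a t) p)‖ ≤ 2 * M := by
    intro t ht
    refine norm_tsum_le_of_tsum_enorm_le (by positivity) ?_
    rw [htwo]
    refine le_trans ?_ (mul_le_mul' le_rfl (key t ht))
    rw [← ENNReal.tsum_mul_left]
    refine ENNReal.tsum_le_tsum fun p => (enorm_add_le _ _).trans ?_
    rw [mul_add, mul_add]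
    refine add_le_add ?_ ?_
    · rw [enorm_mul, enorm_mul, nI, one_mul, enorm_quad, henorm]
      refine le_trans (mul_le_mul' (ENNReal.ofReal_le_ofReal
        (abs_correction_mul_resonance_sub_le s p)) le_rfl) (le_mul_of_one_le_left' one_le_two)
    · rw [enorm_mul, henorm, ← mul_assoc, ← htwo]
      exact mul_le_mul' (ENNReal.ofReal_le_ofReal (abs_correction_le s p)) (enorm_six_le _ p)
  have hQ : ∀ t ∈ uIcc x y, ‖∑' p, ((correction s p / 2 : ℝ) : ℂ) * quad (a t) p‖ ≤ M := by
    intro t ht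
    refine norm_tsum_le_of_tsum_enorm_le hM (le_trans ?_ (key t ht))
    refine ENNReal.tsum_le_tsum fun p => ?_
    rw [enorm_mul, henorm, enorm_quad, abs_div, abs_two]
    refine mul_le_mul' (ENNReal.ofReal_le_ofReal ?_) le_self_add
    linarith [abs_correction_le s p]
  have hsub := norm_modifiedEnergy_sub_le_abs hs le_rfl ha hfin (abs_correction_le_weightSum s)
    (abs_correction_mul_resonance_le s) ⟨S, by rintro _ ⟨t, ht, rfl⟩; exact (hb t ht).2⟩ hD
  rw [modifiedEnergy_eq, modifiedEnergy_eq] at hsub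
  have hre := (Complex.re_le_norm _).trans hsub
  rw [Complex.sub_re, Complex.add_re, Complex.add_re, Complex.ofReal_re, Complex.ofReal_re] at hre
  have q1 := (Complex.abs_re_le_norm _).trans (hQ x left_mem_uIcc)
  have q2 := (Complex.abs_re_le_norm _).trans (hQ y right_mem_uIcc)
  have : C * K ^ 3 * (2 + |y - x|) * S ^ (1 - γ) = M + M + M * |y - x| := by
    simp only [M]; ring
  rw [this]
  linarith [(abs_le.1 q1).2, (abs_le.1 q2).1]

lemma le_of_le_add_mul_rpow {γ A B S : ℝ} (hγ : 0 < γ) (hA : 0 ≤ A) (hB : 0 ≤ B) (hS : 0 < S)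
    (h : S ≤ A + B * S ^ (1 - γ)) : S ≤ 2 * A + (2 * B) ^ (1 / γ) := by
  have h0 : 0 ≤ (2 * B) ^ (1 / γ) := by positivity
  by_cases hc : S ^ γ ≤ 2 * B
  · have := Real.rpow_le_rpow (by positivity) hc (by positivity : 0 ≤ 1 / γ)
    rw [← Real.rpow_mul hS.le, mul_one_div_cancel hγ.ne', Real.rpow_one] at this
    linarith
  · have h1 : S ^ (1 - γ) * S ^ γ = S := by
      rw [← Real.rpow_add hS, sub_add_cancel, Real.rpow_one]
    have h2 : 0 < S ^ (1 - γ) := by positivity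
    nlinarith

/-- The a priori bound for the `H^s` norm on an interval where it is known to be bounded. -/
lemma exists_HsNormSq_growth {s : ℝ} (hs : 1 < s) : ∃ γ C : ℝ, 0 < γ ∧ 0 ≤ C ∧
    ∀ a : ℝ → Z2 → ℂ, IsSolutionV (fun _ => 0) a → (∀ t, HsFinite s (a t)) → ∀ x y R T : ℝ,
    BddAbove ((fun t => HsNormSq s (a t)) '' uIcc x y) → HsNormSq s (a x) ≤ R → |y - x| ≤ T →
    HsNormSq s (a y) ≤
      2 * (1 + R) + (C * (1 + R + R ^ 2 + R ^ 3) ^ 3 * (2 + T)) ^ (1 / γ) := by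
  obtain ⟨γ, C, hγ, hγ1, hC, h⟩ := exists_HsNormSq_le_of_le hs
  obtain ⟨C₁, hC₁, h₁⟩ := exists_HsNormSq_one_le hs
  refine ⟨γ, 2 * (C * (1 + C₁) ^ 3), hγ, by positivity, fun a ha hfin x y R T hb hR hT => ?_⟩
  have hx := HsNormSq_nonneg s (a x)
  have hR0 : 0 ≤ R := hx.trans hR
  have hT0 : 0 ≤ T := (abs_nonneg _).trans hT
  set K := (1 + C₁) * (1 + R + R ^ 2 + R ^ 3)
  have hK1 : 1 ≤ K := by
    have : 0 ≤ C₁ * (1 + R + R ^ 2 + R ^ 3) := by positivity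
    have : 0 ≤ R + R ^ 2 + R ^ 3 := by positivity
    simp only [K]; linarith
  have hsubset : ∀ t ∈ uIcc x y, uIcc x t ⊆ uIcc x y := fun t ht =>
    uIcc_subset_uIcc left_mem_uIcc ht
  have hK : ∀ t ∈ uIcc x y, HsNormSq 1 (a t) ≤ K := by
    intro t ht
    refine (h₁ a ha hfin x t (hb.mono (image_mono (hsubset t ht)))).trans ?_
    have e2 := pow_le_pow_left₀ hx hR 2
    have e3 := pow_le_pow_left₀ hx hR 3
    have : C₁ * (HsNormSq s (a x) ^ 2 + HsNormSq s (a x) ^ 3) ≤ C₁ * (R ^ 2 + R ^ 3) := by gcongr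
    have : 0 ≤ C₁ * (1 + R) := by positivity
    have : 0 ≤ 1 + R ^ 2 + R ^ 3 := by positivity
    simp only [K]; linarith
  set G := sSup ((fun t => HsNormSq s (a t)) '' uIcc x y)
  have hG : ∀ t ∈ uIcc x y, HsNormSq s (a t) ≤ G := fun t ht => le_csSup hb (mem_image_of_mem _ ht)
  set S := max 1 G
  have hS1 : 1 ≤ S := le_max_left _ _
  set B := C * K ^ 3 * (2 + T)
  have hB : 0 ≤ B := by positivity
  have hbound : ∀ t ∈ uIcc x y, HsNormSq s (a t) ≤ R + B * S ^ (1 - γ) := by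
    intro t ht
    have hlen : |t - x| ≤ T := (abs_sub_left_of_mem_uIcc ht).trans hT
    refine (h a ha hfin x t K S hK1 hS1 fun τ hτ => ⟨hK τ (hsubset t ht hτ),
      (hG τ (hsubset t ht hτ)).trans (le_max_right _ _)⟩).trans ?_
    have : C * K ^ 3 * (2 + |t - x|) * S ^ (1 - γ) ≤ B * S ^ (1 - γ) := by
      simp only [B]; gcongr
    linarith
  have hSle : S ≤ (1 + R) + B * S ^ (1 - γ) := by
    have : 0 ≤ B * S ^ (1 - γ) := by positivity
    refine max_le (by linarith) (csSup_le ⟨_, mem_image_of_mem _ left_mem_uIcc⟩ ?_)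
    rintro _ ⟨t, ht, rfl⟩
    exact (hbound t ht).trans (by linarith)
  refine ((hG y right_mem_uIcc).trans (le_max_right 1 G)).trans
    ((le_of_le_add_mul_rpow hγ (by linarith) hB (by linarith) hSle).trans (le_of_eq ?_))
  simp only [B, K]
  ring_nf

/-- A lower semicontinuous function on the line whose values propagate over short intervals where
it is bounded is locally bounded. -/
lemma bddAbove_image_uIcc_of_propagation {g : ℝ → ℝ} (hg : ∀ k, IsClosed {t | g t ≤ k})
    (h : ∀ R, ∃ M, ∀ x y, |y - x| ≤ 1 → BddAbove (g '' uIcc x y) → g x ≤ R → g y ≤ M) (x y : ℝ) :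
    BddAbove (g '' uIcc x y) := by
  let U : Set ℝ := {t | ∃ V ∈ nhds t, BddAbove (g '' V)}
  have hU : IsOpen U := by
    rw [isOpen_iff_mem_nhds]
    rintro t ⟨V, hV, hb⟩
    filter_upwards [eventually_mem_nhds_iff.2 hV] with τ hτ using ⟨V, hτ, hb⟩
  have hcompact : ∀ K : Set ℝ, IsCompact K → K ⊆ U → BddAbove (g '' K) := by
    intro K hK hKU
    refine hK.induction_on (p := fun s => BddAbove (g '' s)) (by simp)
      (fun s t hst ht => ht.mono (image_mono hst))
      (fun s t hs ht => by rw [image_union]; exact hs.union ht) fun t ht => ?_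
    obtain ⟨V, hV, hb⟩ := hKU ht
    exact ⟨V, mem_nhdsWithin_of_mem_nhds hV, hb⟩
  suffices hUuniv : Uᶜ = ∅ by
    exact hcompact _ isCompact_uIcc (by rw [compl_empty_iff.1 hUuniv]; exact subset_univ _)
  by_contra hne
  have hF : IsClosed Uᶜ := hU.isClosed_compl
  have : Nonempty (Uᶜ : Set ℝ) := (nonempty_iff_ne_empty.2 hne).to_subtype
  have : CompleteSpace (Uᶜ : Set ℝ) := hF.completeSpace_coe
  obtain ⟨k, ⟨t₀, ht₀U⟩, ht₀⟩ := nonempty_interior_of_iUnion_of_closed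
    (f := fun k : ℕ => {t : (Uᶜ : Set ℝ) | g t ≤ k})
    (fun k => (hg k).preimage continuous_subtype_val)
    (by
      refine eq_univ_of_forall fun t => mem_iUnion.2 ?_
      exact exists_nat_ge (g t))
  obtain ⟨ε, hε, hball⟩ := Metric.mem_nhds_iff.1 (mem_interior_iff_mem_nhds.1 ht₀)
  have hk : ∀ t ∈ Uᶜ, |t - t₀| < ε → g t ≤ k := fun t ht hd =>
    hball (show (⟨t, ht⟩ : (Uᶜ : Set ℝ)) ∈ Metric.ball _ ε from hd)
  obtain ⟨M, hM⟩ := h k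
  refine ht₀U ⟨Metric.ball t₀ (min ε 1), Metric.ball_mem_nhds _ (by positivity), max k M, ?_⟩
  rintro _ ⟨t, ht, rfl⟩
  rw [Metric.mem_ball, Real.dist_eq, lt_min_iff] at ht
  by_cases htU : t ∈ U
  swap
  · exact (hk t htU ht.1).trans (le_max_left _ _)
  refine le_max_of_le_right ?_
  obtain ⟨α, ⟨hαU, hα⟩, hmin⟩ := ((isCompact_uIcc (a := t₀) (b := t)).inter_left hF).exists_isMinOn
    ⟨t₀, ht₀U, left_mem_uIcc⟩ (f := fun τ => |τ - t|) (by fun_prop)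
  have hαt : uIcc α t ⊆ uIcc t₀ t := uIcc_subset_uIcc hα right_mem_uIcc
  have hαdist : |α - t₀| < ε := (abs_sub_left_of_mem_uIcc hα).trans_lt ht.1
  have hlen : |t - α| ≤ 1 := (abs_sub_right_of_mem_uIcc hα).trans ht.2.le
  refine hM α t hlen ?_ (hk α hαU hαdist)
  obtain ⟨M', hM'⟩ := h (g t)
  refine ⟨max M' (g α), ?_⟩
  rintro _ ⟨τ, hτ, rfl⟩
  by_cases hτα : τ = α
  · rw [hτα]; exact le_max_right _ _
  refine le_max_of_le_left (hM' t τ ?_ ?_ le_rfl)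
  · rw [abs_sub_comm]; exact (abs_sub_right_of_mem_uIcc hτ).trans hlen
  refine hcompact _ isCompact_uIcc fun σ hσ => ?_
  by_contra hσU
  have h1 : |α - t| ≤ |σ - t| :=
    hmin ⟨hσU, hαt (uIcc_subset_uIcc right_mem_uIcc hτ hσ)⟩
  have h2 : |σ - t| ≤ |τ - t| := by
    rw [uIcc_comm] at hσ
    have := abs_sub_right_of_mem_uIcc hσ
    rwa [abs_sub_comm, abs_sub_comm t τ] at this
  have h3 : |τ - t| < |α - t| := by
    rcases mem_uIcc.1 hτ with ⟨h5, h6⟩ | ⟨h5, h6⟩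
    · have := lt_of_le_of_ne h5 (Ne.symm hτα)
      rw [abs_of_nonpos (by linarith), abs_of_nonpos (by linarith)]; linarith
    · have := lt_of_le_of_ne h6 hτα
      rw [abs_of_nonneg (by linarith), abs_of_nonneg (by linarith)]; linarith
  linarith

lemma IsSolutionV.isClosed_HsNormSq_le {s : ℝ} {a : ℝ → Z2 → ℂ} (ha : IsSolutionV (fun _ => 0) a)
    (hfin : ∀ t, HsFinite s (a t)) (k : ℝ) : IsClosed {t | HsNormSq s (a t) ≤ k} := by
  have hc : ∀ n, Continuous fun t => a t n := fun n =>
    continuous_iff_continuousAt.2 fun t => (ha.hasDerivAt n t).continuousAt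
  have : {t | HsNormSq s (a t) ≤ k} =
      ⋂ A : Finset Z2, {t | ∑ n ∈ A, (1 + nsq n) ^ s * ‖a t n‖ ^ 2 ≤ k} := by
    ext t
    simp only [mem_ofPred_eq, mem_iInter]
    refine ⟨fun h A => ((hfin t).sum_le_tsum A fun n _ =>
      mul_nonneg (jb_rpow_nonneg s n) (by positivity)).trans h,
      fun h => (hfin t).tsum_le_of_sum_le h⟩
  rw [this]
  exact isClosed_iInter fun A => isClosed_le (by fun_prop) continuous_const

lemma IsSolutionV.bddAbove_HsNormSq {s : ℝ} (hs : 1 < s) {a : ℝ → Z2 → ℂ}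
    (ha : IsSolutionV (fun _ => 0) a) (hfin : ∀ t, HsFinite s (a t)) (x y : ℝ) :
    BddAbove ((fun t => HsNormSq s (a t)) '' uIcc x y) := by
  obtain ⟨γ, C, -, -, h⟩ := exists_HsNormSq_growth hs
  exact bddAbove_image_uIcc_of_propagation (ha.isClosed_HsNormSq_le hfin)
    (fun R => ⟨_, fun x y hxy hb hR => h a ha hfin x y R 1 hb hR hxy⟩) x y

lemma HsNormSq_eq_zero_of_le {r s : ℝ} {a : Z2 → ℂ} (hr : HsFinite r a) (h : HsNormSq r a ≤ 0) :
    HsNormSq s a = 0 := by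
  have h0 : HsNormSq r a = 0 := le_antisymm h (HsNormSq_nonneg r a)
  have hz := (hr.hasSum_iff.2 h0 |> (hasSum_zero_iff_of_nonneg fun n =>
    mul_nonneg (jb_rpow_nonneg r n) (by positivity)).1)
  have : ∀ n, (1 + nsq n) ^ s * ‖a n‖ ^ 2 = 0 := fun n => by
    have h1 := congrFun hz n
    rcases mul_eq_zero.1 h1 with h2 | h2
    · exact absurd h2 (Real.rpow_pos_of_pos (jb_pos n) r).ne'
    · rw [h2, mul_zero]
  rw [HsNormSq, tsum_congr this, tsum_zero]

lemma eventually_polynomial_bound {γ A B R : ℝ} (hγ : 0 < γ) (hB : 0 ≤ B) (hR : 0 < R) :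
    ∃ t₀ : ℝ, 1 ≤ t₀ ∧ ∀ t, t₀ ≤ t →
      A + (B * (2 + t)) ^ (1 / γ) ≤ t ^ (1 / γ + 1) * R := by
  refine ⟨max 1 ((|A| + (B * 3) ^ (1 / γ)) / R), le_max_left _ _, fun t ht => ?_⟩
  have ht1 : 1 ≤ t := (le_max_left _ _).trans ht
  have ht2 : |A| + (B * 3) ^ (1 / γ) ≤ t * R := (div_le_iff₀ hR).1 ((le_max_right _ _).trans ht)
  have h1 : (B * (2 + t)) ^ (1 / γ) ≤ (B * 3) ^ (1 / γ) * t ^ (1 / γ) := by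
    rw [← Real.mul_rpow (by positivity) (by positivity)]
    refine Real.rpow_le_rpow (by positivity) ?_ (by positivity)
    nlinarith
  have h2 : 1 ≤ t ^ (1 / γ) := Real.one_le_rpow ht1 (by positivity)
  have h3 : A ≤ |A| * t ^ (1 / γ) :=
    (le_abs_self A).trans (le_mul_of_one_le_right (abs_nonneg _) h2)
  rw [Real.rpow_add (by linarith), Real.rpow_one]
  nlinarith

/-- **Bourgain's polynomial upper bound.** Fix `s > 1`. There is a constant `C > 0`
(depending only on `s`) such that every global Fourier-side solution of the cubic defocusing
NLS (the case `v ≡ 0`) with finite `H^s` norms satisfies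
`‖a(t)‖_{H^s} ≤ t^{C(s-1)} ‖a(0)‖_{H^s}` for all sufficiently large `t`. -/
theorem bourgain_polynomial_upper_bound
    (s : ℝ) (hs : 1 < s) :
    ∃ C > (0 : ℝ), ∀ a : ℝ → Z2 → ℂ,
      IsSolutionV (fun _ => 0) a →
      (∀ t : ℝ, HsFinite s (a t)) →
      ∃ t₀ : ℝ, ∀ t : ℝ, t₀ ≤ t →
        HsNorm s (a t) ≤ t ^ (C * (s - 1)) * HsNorm s (a 0) := by
  obtain ⟨γ, B, hγ, hB, h⟩ := exists_HsNormSq_growth hs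
  obtain ⟨C₁, -, h₁⟩ := exists_HsNormSq_one_le hs
  have hs' : 0 < s - 1 := by linarith
  refine ⟨(1 / γ + 1) * (1 / 2) / (s - 1), by positivity, fun a ha hfin => ?_⟩
  have hb := ha.bddAbove_HsNormSq hs hfin
  set R := HsNormSq s (a 0) with hRdef
  rcases (HsNormSq_nonneg s (a 0)).eq_or_lt with hR | hR
  · refine ⟨0, fun t ht => ?_⟩
    have h0 := h₁ a ha hfin 0 t (hb 0 t)
    rw [← hR] at h0
    have : HsNormSq s (a t) = 0 :=
      HsNormSq_eq_zero_of_le ((hfin t).mono hs.le) (h0.trans (by norm_num))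
    rw [HsNorm, this, Real.zero_rpow (by norm_num), HsNorm]
    have := HsNormSq_nonneg s (a 0)
    positivity
  · obtain ⟨t₀, h1, ht₀⟩ := eventually_polynomial_bound (A := 2 * (1 + R)) (R := R)
      (B := B * (1 + R + R ^ 2 + R ^ 3) ^ 3) hγ (by positivity) hR
    refine ⟨t₀, fun t ht => ?_⟩
    have ht0 : 0 ≤ t := by linarith
    have := (h a ha hfin 0 t R t (hb 0 t) le_rfl (by rw [sub_zero, abs_of_nonneg ht0])).trans
      (ht₀ t ht)
    rw [div_mul_cancel₀ _ hs'.ne', Real.rpow_mul ht0, HsNorm, HsNorm, ← hRdef,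
      ← Real.mul_rpow (by positivity) hR.le]
    exact Real.rpow_le_rpow (HsNormSq_nonneg _ _) this (by norm_num)
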